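/- Let 0 ≤ m < n be integers, let E ⊆ ℝⁿ be a compact m-rectifiable set, and let u : ℝⁿ → [0,∞) be a bounded continuous function. Then the m-dimensional u-Minkowski content of E exists and equals the weighted Hausdorff integral: lim_{r→0⁺} H^n(⋃_{x∈E} B(x, u(x)·r)) / (ω(n−m)·r^{n−m}) = ∫_E u(x)^{n−m} dH^m(x). -/

import Mathlib

open MeasureTheory Metric Filter Set

noncomputable section

/-- `ω k`: the Lebesgue volume of the unit ball in `ℝᵏ`. -/
def unitBallVol (k : ℕ) : ℝ :=
  (volume (Metric.ball (0 : EuclideanSpace ℝ (Fin k)) 1)).toReal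

/-- The `d`-dimensional Hausdorff measure on `ℝⁿ`, normalized (à la Federer, with the gauge
`ω(d)·2^{-d}·(diam U)^d`) so that it agrees with Lebesgue measure on `d`-dimensional affine
subspaces. -/
def normHausdorff (n d : ℕ) : Measure (EuclideanSpace ℝ (Fin n)) :=
  (ENNReal.ofReal (unitBallVol d / 2 ^ d)) • μH[(d : ℝ)]

/-- `E ⊆ ℝⁿ` is `m`-rectifiable: there are a bounded set `F ⊆ ℝᵐ` and a Lipschitz map `Ψ`
with `Ψ(F) = E`. -/
def MRectifiable (m n : ℕ) (E : Set (EuclideanSpace ℝ (Fin n))) : Prop :=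
  ∃ (F : Set (EuclideanSpace ℝ (Fin m)))
    (Ψ : EuclideanSpace ℝ (Fin m) → EuclideanSpace ℝ (Fin n)) (K : NNReal),
      Bornology.IsBounded F ∧ LipschitzOnWith K Ψ F ∧ Ψ '' F = E

open scoped ENNReal NNReal Topology Pointwise

/-- One-dimensional Brunn–Minkowski inequality, in midpoint form. -/
theorem volume_add_volume_le_of_midpoint_mem {A B S : Set ℝ} (hA : MeasurableSet A)
    (hB : MeasurableSet B) (hA0 : A.Nonempty) (hB0 : B.Nonempty)
    (h : ∀ x ∈ A, ∀ y ∈ B, midpoint ℝ x y ∈ S) :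
    volume A + volume B ≤ 2 * volume S := by
  have key : ∀ K L : Set ℝ, IsCompact K → IsCompact L → K ⊆ A → L ⊆ B → K.Nonempty → L.Nonempty →
      volume K + volume L ≤ 2 * volume S := by
    intro K L hK hL hKA hLB hK0 hL0
    obtain ⟨a, haK, ha⟩ := hK.exists_isGreatest hK0
    obtain ⟨b, hbL, hb⟩ := hL.exists_isLeast hL0
    have hd : AEDisjoint volume ((fun x => x + b) '' K) ((fun x => x + a) '' L) := by
      refine measure_mono_null (t := {a + b}) ?_ (by simp)
      rintro _ ⟨⟨x, hx, rfl⟩, ⟨y, hy, hxy⟩⟩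
      have h1 : x ≤ a := ha hx
      have h2 : b ≤ y := hb hy
      simp only at hxy
      simp only [mem_singleton_iff]; linarith
    have hm : MeasurableSet ((fun x => x + a) '' L) :=
      (hL.image (by fun_prop)).measurableSet
    have hu := measure_union₀ hm.nullMeasurableSet hd
    have hsub : (fun x => x + b) '' K ∪ (fun x => x + a) '' L ⊆ (2 : ℝ) • S := by
      rintro _ (⟨x, hx, rfl⟩ | ⟨x, hx, rfl⟩)
      · refine ⟨_, h x (hKA hx) b (hLB hbL), ?_⟩
        simp [midpoint_eq_smul_add]
      · refine ⟨_, h a (hKA haK) x (hLB hx), ?_⟩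
        simp [midpoint_eq_smul_add, add_comm]
    have h2 := measure_mono (μ := volume) hsub
    rw [hu, Measure.addHaar_smul] at h2
    simpa using h2
  have step : ∀ {T : Set ℝ}, MeasurableSet T → T.Nonempty → ∀ c : ℝ≥0∞, ∀ M : ℝ≥0∞,
      (∀ K ⊆ T, IsCompact K → K.Nonempty → volume K + c ≤ M) → volume T + c ≤ M := by
    intro T hT hT0 c M hM
    rcases eq_or_ne (volume T) 0 with h0 | h0
    · obtain ⟨x, hx⟩ := hT0
      have := hM {x} (by simpa using hx) isCompact_singleton (singleton_nonempty x)
      simpa [h0] using this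
    · rw [hT.measure_eq_iSup_isCompact]
      simp only [iSup_and', ENNReal.iSup_add]
      refine iSup_le fun K => ?_
      rcases em (K ⊆ T ∧ IsCompact K) with hK | hK
      · rcases K.eq_empty_or_nonempty with rfl | hK0
        · obtain ⟨x, hx⟩ := hT0
          have := hM {x} (by simpa using hx) isCompact_singleton (singleton_nonempty x)
          simpa using this
        · simpa [hK] using hM K hK.1 hK.2 hK0
      · obtain ⟨x, hx⟩ := hT0
        have := hM {x} (by simpa using hx) isCompact_singleton (singleton_nonempty x)
        simpa [hK] using this
  refine step hA hA0 _ _ fun K hKA hK hK0 => ?_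
  rw [add_comm]
  refine step hB hB0 _ _ fun L hLB hL hL0 => ?_
  rw [add_comm]
  exact key K L hK hL hKA hLB hK0 hL0

/-- The Prékopa–Leindler property (for midpoints) of a measure on a real vector space. -/
def PrekopaLeindler {α : Type*} [AddCommGroup α] [Module ℝ α] [MeasurableSpace α]
    (μ : Measure α) : Prop :=
  ∀ f g h : α → ℝ≥0∞, Measurable f → Measurable g → Measurable h →
    (∀ x y, f x * g y ≤ h (midpoint ℝ x y) ^ 2) →
    (∫⁻ x, f x ∂μ) * (∫⁻ x, g x ∂μ) ≤ (∫⁻ x, h x ∂μ) ^ 2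

theorem PrekopaLeindler.prod {α β : Type*} [AddCommGroup α] [Module ℝ α] [MeasurableSpace α]
    [AddCommGroup β] [Module ℝ β] [MeasurableSpace β] {μ : Measure α} {ν : Measure β}
    [SFinite μ] [SFinite ν] (hμ : PrekopaLeindler μ) (hν : PrekopaLeindler ν) :
    PrekopaLeindler (μ.prod ν) := by
  intro f g h hf hg hh H
  rw [lintegral_prod _ hf.aemeasurable, lintegral_prod _ hg.aemeasurable,
    lintegral_prod _ hh.aemeasurable]
  refine hμ _ _ _ hf.lintegral_prod_right' hg.lintegral_prod_right' hh.lintegral_prod_right' ?_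
  intro x y
  refine hν _ _ _ (by fun_prop) (by fun_prop) (by fun_prop) fun s t => ?_
  have := H (x, s) (y, t)
  simpa [midpoint_eq_smul_add] using this

theorem PrekopaLeindler.of_linearEquiv {α β : Type*} [AddCommGroup α] [Module ℝ α]
    [MeasurableSpace α] [AddCommGroup β] [Module ℝ β] [MeasurableSpace β] {μ : Measure α}
    {ν : Measure β} (hμ : PrekopaLeindler μ) (e : α →ₗ[ℝ] β) (he : MeasurePreserving e μ ν) :
    PrekopaLeindler ν := by
  intro f g h hf hg hh H
  rw [← he.lintegral_comp hf, ← he.lintegral_comp hg, ← he.lintegral_comp hh]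
  refine hμ _ _ _ (hf.comp he.measurable) (hg.comp he.measurable) (hh.comp he.measurable) ?_
  intro x y
  have := H (e x) (e y)
  simpa [midpoint_eq_smul_add] using this


theorem ENNReal.four_mul_mul_le_sq_add (a b : ℝ≥0∞) : 4 * (a * b) ≤ (a + b) ^ 2 := by
  rcases eq_or_ne a ∞ with rfl | ha
  · simp
  rcases eq_or_ne b ∞ with rfl | hb
  · simp
  lift a to ℝ≥0 using ha
  lift b to ℝ≥0 using hb
  norm_cast
  rw [← NNReal.coe_le_coe]
  push_cast
  nlinarith [sq_nonneg ((a : ℝ) - b)]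

theorem lintegral_eq_lintegral_measure_lt_of_le_one {f : ℝ → ℝ≥0∞} (hf : Measurable f)
    (hf1 : ∀ x, f x ≤ 1) :
    ∫⁻ x, f x = ∫⁻ t in Ioo (0 : ℝ) 1, volume {x | ENNReal.ofReal t < f x} := by
  have hfin : ∀ x, f x ≠ ∞ := fun x => ne_top_of_le_ne_top ENNReal.one_ne_top (hf1 x)
  have h1 : ∫⁻ x, f x = ∫⁻ x, ENNReal.ofReal (f x).toReal :=
    lintegral_congr fun x => (ENNReal.ofReal_toReal (hfin x)).symm
  rw [h1, lintegral_eq_lintegral_meas_lt _ (ae_of_all _ fun x => ENNReal.toReal_nonneg)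
    hf.ennreal_toReal.aemeasurable]
  have h2 : ∀ t ∈ Ioi (0 : ℝ), volume {a | t < (f a).toReal} =
      (Ioo (0 : ℝ) 1).indicator (fun t => volume {x | ENNReal.ofReal t < f x}) t := by
    intro t ht
    by_cases ht1 : t < 1
    · rw [indicator_of_mem (show t ∈ Ioo (0 : ℝ) 1 from ⟨ht, ht1⟩)]
      congr 1
      ext x
      simp only [mem_ofPred_eq]
      rw [ENNReal.ofReal_lt_iff_lt_toReal (le_of_lt ht) (hfin x)]
    · rw [indicator_of_notMem (fun h => ht1 h.2)]
      have : {a | t < (f a).toReal} = ∅ := by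
        ext x
        simp only [mem_ofPred_eq, mem_empty_iff_false, iff_false, not_lt]
        exact (ENNReal.toReal_mono ENNReal.one_ne_top (hf1 x)).trans (by simpa using ht1)
      simp [this]
  rw [setLIntegral_congr_fun measurableSet_Ioi h2, lintegral_indicator measurableSet_Ioo,
    Measure.restrict_restrict measurableSet_Ioo]
  congr 2
  ext t
  simp only [mem_inter_iff, mem_Ioo, mem_Ioi]
  tauto

theorem prekopaLeindler_normalized {f g h : ℝ → ℝ≥0∞} (hf : Measurable f) (hg : Measurable g)
    (hh : Measurable h) (hf1 : ⨆ x, f x = 1) (hg1 : ⨆ x, g x = 1)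
    (H : ∀ x y, f x * g y ≤ h (midpoint ℝ x y) ^ 2) :
    (∫⁻ x, f x) + ∫⁻ x, g x ≤ 2 * ∫⁻ x, h x := by
  have hfle : ∀ x, f x ≤ 1 := fun x => hf1 ▸ le_iSup f x
  have hgle : ∀ x, g x ≤ 1 := fun x => hg1 ▸ le_iSup g x
  have hmin : ∫⁻ x, min (h x) 1 ≤ ∫⁻ x, h x := lintegral_mono fun x => min_le_left _ _
  refine le_trans ?_ (mul_le_mul_right hmin 2)
  rw [lintegral_eq_lintegral_measure_lt_of_le_one hf hfle,
    lintegral_eq_lintegral_measure_lt_of_le_one hg hgle,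
    lintegral_eq_lintegral_measure_lt_of_le_one (hh.min measurable_const)
      (fun x => min_le_right _ _)]
  have hanti : ∀ k : ℝ → ℝ≥0∞, Measurable fun t : ℝ => volume {x | ENNReal.ofReal t < k x} := by
    intro k
    refine Antitone.measurable fun s t hst => measure_mono fun x hx => ?_
    exact lt_of_le_of_lt (ENNReal.ofReal_le_ofReal hst) hx
  rw [← lintegral_add_left (hanti f), ← lintegral_const_mul _ (hanti _)]
  refine setLIntegral_mono' measurableSet_Ioo fun t ht => ?_
  have ht1 : ENNReal.ofReal t < 1 := by simpa using ht.2
  refine volume_add_volume_le_of_midpoint_mem (measurableSet_lt measurable_const hf)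
    (measurableSet_lt measurable_const hg) ?_ ?_ ?_
  · exact lt_iSup_iff.1 (hf1 ▸ ht1)
  · exact lt_iSup_iff.1 (hg1 ▸ ht1)
  · intro x hx y hy
    simp only [mem_ofPred_eq, lt_min_iff] at hx hy ⊢
    refine ⟨?_, ht1⟩
    by_contra! hcon
    have h1 : h (midpoint ℝ x y) ^ 2 ≤ ENNReal.ofReal t * ENNReal.ofReal t := by
      rw [sq]; gcongr
    have h2 : ENNReal.ofReal t * ENNReal.ofReal t < f x * g y := ENNReal.mul_lt_mul hx hy
    exact absurd (h2.trans_le ((H x y).trans h1)) (lt_irrefl _)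

theorem prekopaLeindler_real : PrekopaLeindler (volume : Measure ℝ) := by
  have bdd : ∀ f g h : ℝ → ℝ≥0∞, Measurable f → Measurable g → Measurable h →
      (⨆ x, f x ≠ ∞) → (⨆ x, g x ≠ ∞) → (∀ x y, f x * g y ≤ h (midpoint ℝ x y) ^ 2) →
      (∫⁻ x, f x) * (∫⁻ x, g x) ≤ (∫⁻ x, h x) ^ 2 := by
    intro f g h hf hg hh hfb hgb H
    set a := ⨆ x, f x with ha
    set b := ⨆ x, g x with hb
    rcases eq_or_ne a 0 with ha0 | ha0
    · have : f = 0 := funext fun x => by simpa using (le_iSup f x).trans ha0.le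
      simp [this]
    rcases eq_or_ne b 0 with hb0 | hb0
    · have : g = 0 := funext fun x => by simpa using (le_iSup g x).trans hb0.le
      simp [this]
    set c := (a * b) ^ (1 / 2 : ℝ) with hc
    have hc2 : c ^ 2 = a * b := by
      rw [hc, ← ENNReal.rpow_natCast, ← ENNReal.rpow_mul]; norm_num
    have hab0 : a * b ≠ 0 := mul_ne_zero ha0 hb0
    have habt : a * b ≠ ∞ := ENNReal.mul_ne_top hfb hgb
    have key := prekopaLeindler_normalized (f := fun x => a⁻¹ * f x) (g := fun x => b⁻¹ * g x)
      (h := fun x => c⁻¹ * h x) (by fun_prop) (by fun_prop) (by fun_prop)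
      (by rw [← ENNReal.mul_iSup, ENNReal.inv_mul_cancel ha0 hfb])
      (by rw [← ENNReal.mul_iSup, ENNReal.inv_mul_cancel hb0 hgb]) (by
        intro x y
        calc a⁻¹ * f x * (b⁻¹ * g y) = (a * b)⁻¹ * (f x * g y) := by
              rw [ENNReal.mul_inv (Or.inl ha0) (Or.inl hfb)]; ring
          _ ≤ (a * b)⁻¹ * (h (midpoint ℝ x y)) ^ 2 := by gcongr; exact H x y
          _ = _ := by rw [mul_pow, ← hc2, ENNReal.inv_pow])
    rw [lintegral_const_mul _ hf, lintegral_const_mul _ hg, lintegral_const_mul _ hh] at key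
    set F := ∫⁻ x, f x
    set G := ∫⁻ x, g x
    set I := ∫⁻ x, h x
    have h4 := (ENNReal.four_mul_mul_le_sq_add (a⁻¹ * F) (b⁻¹ * G)).trans
      (pow_le_pow_left' key 2)
    have e1 : 4 * (a⁻¹ * F * (b⁻¹ * G)) = 4 * (a * b)⁻¹ * (F * G) := by
      rw [ENNReal.mul_inv (Or.inl ha0) (Or.inl hfb)]; ring
    have e2 : (2 * (c⁻¹ * I)) ^ 2 = 4 * (a * b)⁻¹ * I ^ 2 := by
      rw [mul_pow, mul_pow, ← ENNReal.inv_pow, hc2]; ring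
    rw [e1, e2] at h4
    refine (ENNReal.mul_le_mul_iff_right ?_ ?_).1 h4
    · simp [habt]
    · exact ENNReal.mul_ne_top (by simp) (by simpa using hab0)
  intro f g h hf hg hh H
  have trunc : ∀ k : ℝ → ℝ≥0∞, Measurable k →
      ∫⁻ x, k x = ⨆ N : ℕ, ∫⁻ x, min (k x) N := by
    intro k hk
    rw [← lintegral_iSup (fun N => hk.min measurable_const)
      (fun N M hNM x => min_le_min_left _ (by exact_mod_cast hNM))]
    refine lintegral_congr fun x => ?_
    refine le_antisymm ?_ (iSup_le fun N => min_le_left _ _)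
    have : (⨆ N : ℕ, min (k x) (N : ℝ≥0∞)) = min (k x) (⨆ N : ℕ, (N : ℝ≥0∞)) :=
      (inf_iSup_eq _ _).symm
    rw [this, ENNReal.iSup_natCast]; simp
  rw [trunc f hf, trunc g hg, ENNReal.iSup_mul]
  refine iSup_le fun N => ?_
  rw [ENNReal.mul_iSup]
  refine iSup_le fun M => ?_
  refine bdd _ _ _ (hf.min measurable_const) (hg.min measurable_const) hh ?_ ?_ fun x y => ?_
  · exact ne_top_of_le_ne_top (ENNReal.natCast_ne_top N) (iSup_le fun x => min_le_right _ _)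
  · exact ne_top_of_le_ne_top (ENNReal.natCast_ne_top M) (iSup_le fun x => min_le_right _ _)
  · exact (mul_le_mul' (min_le_left _ _) (min_le_left _ _)).trans (H x y)

theorem prekopaLeindler_pi (d : ℕ) : PrekopaLeindler (volume : Measure (Fin d → ℝ)) := by
  induction d with
  | zero =>
    intro f g h hf hg hh H
    rw [Measure.volume_pi_eq_dirac 0, lintegral_dirac, lintegral_dirac, lintegral_dirac]
    simpa using H 0 0
  | succ d ih =>
    let e : ℝ × (Fin d → ℝ) →ₗ[ℝ] (Fin (d + 1) → ℝ) := (Fin.consLinearEquiv ℝ fun _ => ℝ).toLinearMap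
    refine (prekopaLeindler_real.prod ih).of_linearEquiv e ?_
    have := (volume_preserving_piFinSuccAbove (fun _ : Fin (d + 1) => ℝ) 0).symm
    have heq : (e : ℝ × (Fin d → ℝ) → Fin (d + 1) → ℝ) =
        (MeasurableEquiv.piFinSuccAbove (fun _ : Fin (d + 1) => ℝ) 0).symm := by
      ext x i
      refine Fin.cases ?_ (fun j => ?_) i <;>
        simp [e, MeasurableEquiv.piFinSuccAbove, Fin.consLinearEquiv]
    rw [heq]
    exact this

theorem prekopaLeindler_euclidean (d : ℕ) :
    PrekopaLeindler (volume : Measure (EuclideanSpace ℝ (Fin d))) :=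
  (prekopaLeindler_pi d).of_linearEquiv (WithLp.linearEquiv 2 ℝ (Fin d → ℝ)).symm.toLinearMap
    (PiLp.volume_preserving_toLp (Fin d))

theorem unitBallVol_pos (d : ℕ) : 0 < unitBallVol d :=
  ENNReal.toReal_pos (measure_ball_pos _ _ one_pos).ne' measure_ball_lt_top.ne

theorem ofReal_unitBallVol (d : ℕ) :
    ENNReal.ofReal (unitBallVol d) = volume (ball (0 : EuclideanSpace ℝ (Fin d)) 1) :=
  ENNReal.ofReal_toReal measure_ball_lt_top.ne

theorem volume_closedBall_euclidean (d : ℕ) (x : EuclideanSpace ℝ (Fin d)) {r : ℝ} (hr : 0 ≤ r) :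
    volume (closedBall x r) = ENNReal.ofReal (unitBallVol d * r ^ d) := by
  rw [Measure.addHaar_closedBall _ _ hr, ENNReal.ofReal_mul (unitBallVol_pos d).le,
    ofReal_unitBallVol, finrank_euclideanSpace_fin, mul_comm]

theorem volume_ball_euclidean {d : ℕ} (x : EuclideanSpace ℝ (Fin d)) {r : ℝ} (hr : 0 < r) :
    volume (ball x r) = ENNReal.ofReal (unitBallVol d * r ^ d) := by
  rw [Measure.addHaar_ball_of_pos _ _ hr, ENNReal.ofReal_mul (unitBallVol_pos d).le,
    ofReal_unitBallVol, finrank_euclideanSpace_fin, mul_comm]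

/-- The isodiametric inequality. -/
theorem volume_le_ediam_pow (d : ℕ) (s : Set (EuclideanSpace ℝ (Fin d))) :
    volume s ≤ ENNReal.ofReal (unitBallVol d / 2 ^ d) * ediam s ^ d := by
  have hpos : 0 < unitBallVol d / 2 ^ d := div_pos (unitBallVol_pos d) (by positivity)
  by_cases htop : ediam s = ∞
  · rcases d.eq_zero_or_pos with rfl | hd
    · simp [ediam_subsingleton s.subsingleton_of_subsingleton] at htop
    · rw [htop, ENNReal.top_pow hd.ne', ENNReal.mul_top (by simpa using hpos)]
      exact le_top
  set K := closure s with hK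
  have hKm : MeasurableSet K := isClosed_closure.measurableSet
  have hbdd : Bornology.IsBounded K := by
    rw [Metric.isBounded_iff_ediam_ne_top, hK, Metric.ediam_closure]; exact htop
  have hD : ∀ x ∈ K, ∀ y ∈ K, dist x y ≤ diam K := fun x hx y hy => dist_le_diam_of_mem hbdd hx hy
  have key := prekopaLeindler_euclidean d (K.indicator 1) ((-K).indicator 1)
    ((closedBall 0 (diam K / 2)).indicator 1) (measurable_one.indicator hKm)
    (measurable_one.indicator hKm.neg) (measurable_one.indicator measurableSet_closedBall) (by
      intro x y
      by_cases hx : x ∈ K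
      swap; · simp [hx]
      by_cases hy : y ∈ -K
      swap; · simp [indicator_of_notMem hy]
      have : midpoint ℝ x y ∈ closedBall (0 : EuclideanSpace ℝ (Fin d)) (diam K / 2) := by
        rw [mem_closedBall_zero_iff, midpoint_eq_smul_add, norm_smul]
        have := hD x hx (-y) hy
        rw [dist_eq_norm, sub_neg_eq_add] at this
        norm_num
        linarith
      simp [hx, hy, this])
  rw [lintegral_indicator_one hKm, lintegral_indicator_one hKm.neg,
    lintegral_indicator_one measurableSet_closedBall, Measure.measure_neg, ← sq,
    volume_closedBall_euclidean _ _ (by positivity)] at key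
  have key2 : volume K ≤ ENNReal.ofReal (unitBallVol d * (diam K / 2) ^ d) :=
    (ENNReal.pow_le_pow_left_iff two_ne_zero).1 key
  refine (measure_mono subset_closure).trans (key2.trans_eq ?_)
  rw [← ediam_closure s, ← hK, ← ENNReal.ofReal_toReal (hbdd.ediam_ne_top),
    ← ENNReal.ofReal_pow ENNReal.toReal_nonneg, ← ENNReal.ofReal_mul hpos.le, diam]
  congr 1
  rw [div_pow]; ring

theorem normHausdorff_self (d : ℕ) : normHausdorff d d = volume := by
  have hpos : 0 < unitBallVol d / 2 ^ d := div_pos (unitBallVol_pos d) (by positivity)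
  set c := ENNReal.ofReal (unitBallVol d / 2 ^ d) with hc
  have hc0 : c ≠ 0 := by simpa [hc] using hpos
  have hct : c ≠ ∞ := ENNReal.ofReal_ne_top
  refine le_antisymm ?_ ?_
  · refine Measure.le_iff.2 fun s _ => ?_
    change c * μH[d] s ≤ volume s
    have step : ∀ ε : ℝ≥0∞, ε ≠ 0 → μH[d] s ≤ c⁻¹ * (volume s + ε) := by
      intro ε hε
      choose t r ht hts hr hst hsum using fun N : ℕ =>
        Besicovitch.exists_closedBall_covering_tsum_measure_le (volume : Measure
          (EuclideanSpace ℝ (Fin d))) hε (fun _ => Ioo 0 (1 / ((N : ℝ) + 1))) s (by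
          intro x _ δ hδ
          refine ⟨min δ (1 / ((N : ℝ) + 1)) / 2, ?_⟩
          have h1 : 0 < 1 / ((N : ℝ) + 1) := by positivity
          have h2 : 0 < min δ (1 / ((N : ℝ) + 1)) := lt_min hδ h1
          have h3 := min_le_left δ (1 / ((N : ℝ) + 1))
          have h4 := min_le_right δ (1 / ((N : ℝ) + 1))
          constructor <;> constructor <;> linarith)
      have : ∀ N, Countable (t N) := fun N => (ht N).to_subtype
      have hdiam : ∀ N, ∀ i : t N, ediam (closedBall (i : EuclideanSpace ℝ (Fin d)) (r N i)) ≤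
          ENNReal.ofReal (2 * r N i) := by
        intro N i
        refine ediam_le fun x hx y hy => ?_
        rw [edist_dist]
        refine ENNReal.ofReal_le_ofReal ?_
        have := dist_triangle_right x y (i : EuclideanSpace ℝ (Fin d))
        rw [mem_closedBall] at hx hy
        linarith
      have hlim : Tendsto (fun N : ℕ => ENNReal.ofReal (2 * (1 / ((N : ℝ) + 1)))) atTop (𝓝 0) := by
        have := (tendsto_one_div_add_atTop_nhds_zero_nat (𝕜 := ℝ)).const_mul 2
        simpa using ENNReal.tendsto_ofReal this
      refine (Measure.hausdorffMeasure_le_liminf_tsum (d : ℝ) s _ hlim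
        (fun N (i : t N) => closedBall (i : EuclideanSpace ℝ (Fin d)) (r N i)) ?_ ?_).trans ?_
      · refine Eventually.of_forall fun N i => (hdiam N i).trans (ENNReal.ofReal_le_ofReal ?_)
        have := (hr N i i.2).2.le
        linarith
      · refine Eventually.of_forall fun N => ?_
        rw [iUnion_subtype]; exact hst N
      · refine (liminf_le_of_le (by isBoundedDefault) fun b hb => ?_)
        obtain ⟨N, hN⟩ := hb.exists
        refine hN.trans (le_trans ?_ (mul_le_mul_right (hsum N) _))
        rw [← ENNReal.tsum_mul_left]
        refine ENNReal.tsum_le_tsum fun i => ?_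
        have hri := (hr N i i.2).1.le
        rw [volume_closedBall_euclidean _ _ hri, ENNReal.rpow_natCast]
        refine (pow_le_pow_left' (hdiam N i) d).trans_eq ?_
        rw [hc, ← ENNReal.ofReal_inv_of_pos hpos, ← ENNReal.ofReal_mul (by positivity),
          ← ENNReal.ofReal_pow (by positivity)]
        congr 1
        have := (unitBallVol_pos d).ne'
        field_simp
        rw [mul_pow]
    have : μH[d] s ≤ c⁻¹ * volume s := by
      have hlim : Tendsto (fun ε : ℝ≥0∞ => c⁻¹ * (volume s + ε)) (𝓝[>] 0)
          (𝓝 (c⁻¹ * (volume s + 0))) :=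
        ENNReal.Tendsto.const_mul (tendsto_const_nhds.add nhdsWithin_le_nhds)
          (Or.inr (by simpa using hc0))
      rw [add_zero] at hlim
      exact ge_of_tendsto hlim (eventually_nhdsWithin_of_forall fun ε hε => step ε (ne_of_gt hε))
    calc c * μH[d] s ≤ c * (c⁻¹ * volume s) := by gcongr
      _ = volume s := by rw [← mul_assoc, ENNReal.mul_inv_cancel hc0 hct, one_mul]
  · have h := Measure.le_hausdorffMeasure (d : ℝ)
      (c⁻¹ • (volume : Measure (EuclideanSpace ℝ (Fin d)))) 1 one_pos (by
        intro s _
        rw [Measure.smul_apply, smul_eq_mul, ENNReal.rpow_natCast]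
        calc c⁻¹ * volume s ≤ c⁻¹ * (c * ediam s ^ d) := by
              gcongr; exact volume_le_ediam_pow d s
          _ = _ := by rw [← mul_assoc, ENNReal.inv_mul_cancel hc0 hct, one_mul])
    refine Measure.le_iff.2 fun s hs => ?_
    change volume s ≤ c * μH[d] s
    calc volume s = c * (c⁻¹ * volume s) := by
          rw [← mul_assoc, ENNReal.mul_inv_cancel hc0 hct, one_mul]
      _ ≤ c * μH[d] s := by gcongr; exact h s

/-- Orthogonal splitting of `ℝⁿ` along an `m`-dimensional subspace, in coordinates. -/
theorem exists_orthogonal_splitting {m n : ℕ} (V : Submodule ℝ (EuclideanSpace ℝ (Fin n)))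
    (hV : Module.finrank ℝ V = m) :
    ∃ Φ : EuclideanSpace ℝ (Fin n) ≃ᵐ
        EuclideanSpace ℝ (Fin m) × EuclideanSpace ℝ (Fin (n - m)),
      MeasurePreserving Φ volume volume ∧ Continuous Φ ∧
      (∀ x y, Φ (x - y) = Φ x - Φ y) ∧
      (∀ x, ‖x‖ ^ 2 = ‖(Φ x).1‖ ^ 2 + ‖(Φ x).2‖ ^ 2) ∧ (∀ x ∈ V, (Φ x).2 = 0) ∧
      ∀ x, ∃ v ∈ V, (Φ (x - v)).1 = 0 := by
  have hV' : Module.finrank ℝ Vᗮ = n - m := by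
    have := V.finrank_add_finrank_orthogonal
    rw [finrank_euclideanSpace_fin] at this
    omega
  let a : V ≃ₗᵢ[ℝ] EuclideanSpace ℝ (Fin m) := ((stdOrthonormalBasis ℝ V).reindex (finCongr hV)).repr
  let b : Vᗮ ≃ₗᵢ[ℝ] EuclideanSpace ℝ (Fin (n - m)) :=
    ((stdOrthonormalBasis ℝ Vᗮ).reindex (finCongr hV')).repr
  let Φ : EuclideanSpace ℝ (Fin n) ≃ᵐ
        EuclideanSpace ℝ (Fin m) × EuclideanSpace ℝ (Fin (n - m)) :=
    V.orthogonalDecomposition.toHomeomorph.toMeasurableEquiv.trans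
      ((MeasurableEquiv.toLp 2 _).symm.trans
        (a.toHomeomorph.toMeasurableEquiv.prodCongr b.toHomeomorph.toMeasurableEquiv))
  have hΦ : ∀ x, Φ x = (a (V.orthogonalDecomposition x).fst,
    b (V.orthogonalDecomposition x).snd) := fun x => rfl
  refine ⟨Φ, ?_, ?_, ?_, ?_, ?_, ?_⟩
  · refine (a.measurePreserving.prod b.measurePreserving).comp ?_
    exact (WithLp.volume_preserving_ofLp _ _).comp V.orthogonalDecomposition.measurePreserving
  · simp only [funext hΦ]
    fun_prop
  · intro x y
    simp [hΦ]
  · intro x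
    rw [hΦ]
    simp only [LinearIsometryEquiv.norm_map]
    rw [← WithLp.prod_norm_sq_eq_of_L2, LinearIsometryEquiv.norm_map]
  · intro x hx
    rw [hΦ]
    simp [Submodule.orthogonalDecomposition_apply, Submodule.orthogonalProjectionOnto_orthogonal_apply_eq_zero, hx]
  · intro x
    refine ⟨V.starProjection x, V.starProjection_apply_mem x, ?_⟩
    rw [hΦ]
    have : V.orthogonalProjectionOnto (V.starProjection x) = V.orthogonalProjectionOnto x := by
      rw [Submodule.starProjection_apply, Submodule.orthogonalProjectionOnto_mem_subspace_eq_self]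
    simp [Submodule.orthogonalDecomposition_apply, this]

/-- A set `S ⊆ ℝⁿ` is comparable, with distortion `η`, to a compact set `T ⊆ ℝᵐ`, as far as its
`m`-dimensional measure and the volume of its tubular neighbourhoods are concerned. -/
structure IsAlmostFlat (m n : ℕ) (η : ℝ) (S : Set (EuclideanSpace ℝ (Fin n)))
    (T : Set (EuclideanSpace ℝ (Fin m))) : Prop where
  isCompact : IsCompact T
  volume_le : volume T ≤ normHausdorff n m S
  le_volume : normHausdorff n m S ≤ ENNReal.ofReal ((1 + η) ^ m) * volume T
  le_volume_thickening : ∀ ρ > 0,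
    volume T * ENNReal.ofReal (unitBallVol (n - m) * ρ ^ (n - m)) ≤ volume (thickening ρ S)
  volume_thickening_le : ∀ ρ > 0, volume (thickening ρ S) ≤
    volume (thickening ρ T) * ENNReal.ofReal (unitBallVol (n - m) * ((1 + 2 * η) * ρ) ^ (n - m))

theorem isAlmostFlat_of_graph {m n : ℕ} {η : ℝ} (hη : 0 ≤ η)
    (Φ : EuclideanSpace ℝ (Fin n) ≃ᵐ
        EuclideanSpace ℝ (Fin m) × EuclideanSpace ℝ (Fin (n - m)))
    (hΦ : MeasurePreserving Φ volume volume) (hΦc : Continuous Φ)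
    (hsub : ∀ x y, Φ (x - y) = Φ x - Φ y)
    (hnorm : ∀ x, ‖x‖ ^ 2 = ‖(Φ x).1‖ ^ 2 + ‖(Φ x).2‖ ^ 2)
    {S : Set (EuclideanSpace ℝ (Fin n))} (hS : IsCompact S)
    (hgraph : ∀ s ∈ S, ∀ t ∈ S, ‖(Φ s).2 - (Φ t).2‖ ≤ η * ‖(Φ s).1 - (Φ t).1‖) :
    IsAlmostFlat m n η S ((fun x => (Φ x).1) '' S) := by
  set p : EuclideanSpace ℝ (Fin n) → EuclideanSpace ℝ (Fin m) := fun x => (Φ x).1 with hp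
  have hpc : Continuous p := by fun_prop
  have hT : IsCompact (p '' S) := hS.image hpc
  have hdist : ∀ x y, dist x y ^ 2 = dist (Φ x).1 (Φ y).1 ^ 2 + dist (Φ x).2 (Φ y).2 ^ 2 := by
    intro x y
    rw [dist_eq_norm, hnorm, hsub, dist_eq_norm, dist_eq_norm, Prod.fst_sub, Prod.snd_sub]
  have hd1 : ∀ x y, dist (Φ x).1 (Φ y).1 ≤ dist x y := fun x y =>
    abs_le_of_sq_le_sq' (by nlinarith [hdist x y, sq_nonneg (dist (Φ x).2 (Φ y).2)])
      dist_nonneg |>.2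
  have hd2 : ∀ x y, dist (Φ x).2 (Φ y).2 ≤ dist x y := fun x y =>
    abs_le_of_sq_le_sq' (by nlinarith [hdist x y, sq_nonneg (dist (Φ x).1 (Φ y).1)])
      dist_nonneg |>.2
  have hd3 : ∀ x y, dist x y ≤ dist (Φ x).1 (Φ y).1 + dist (Φ x).2 (Φ y).2 := fun x y =>
    abs_le_of_sq_le_sq' (by
      have := mul_nonneg (dist_nonneg (x := (Φ x).1) (y := (Φ y).1))
        (dist_nonneg (x := (Φ x).2) (y := (Φ y).2))
      nlinarith [hdist x y]) (by positivity) |>.2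
  have hgraph' : ∀ s ∈ S, ∀ t ∈ S, dist (Φ s).2 (Φ t).2 ≤ η * dist (Φ s).1 (Φ t).1 := by
    simpa only [dist_eq_norm] using hgraph
  have hslice : ∀ ρ, volume (thickening ρ S) =
      ∫⁻ y, volume {z | Φ.symm (y, z) ∈ thickening ρ S} := by
    intro ρ
    have hm : MeasurableSet (thickening ρ S) := isOpen_thickening.measurableSet
    rw [← (hΦ.symm Φ).measure_preimage hm.nullMeasurableSet, Measure.volume_eq_prod,
      Measure.prod_apply (hm.preimage Φ.symm.measurable)]
    rfl
  refine ⟨hT, ?_, ?_, ?_, ?_⟩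
  · rw [← normHausdorff_self m]
    have hL : LipschitzOnWith 1 p S :=
      (LipschitzWith.of_dist_le_mul fun x y => by simpa using hd1 x y).lipschitzOnWith
    have := hL.hausdorffMeasure_image_le (d := (m : ℝ)) (by positivity)
    simp only [normHausdorff, Measure.smul_apply, smul_eq_mul]
    gcongr
    simpa using this
  · rw [← normHausdorff_self m]
    set g := Function.invFunOn p S
    have hg : ∀ y ∈ p '' S, g y ∈ S ∧ p (g y) = y := fun y hy =>
      ⟨Function.invFunOn_mem hy, Function.invFunOn_eq hy⟩
    have hL : LipschitzOnWith (Real.toNNReal (1 + η)) g (p '' S) := by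
      refine LipschitzOnWith.of_dist_le_mul fun y hy z hz => ?_
      have h1 := hd3 (g y) (g z)
      have h2 := hgraph' _ (hg y hy).1 _ (hg z hz).1
      have h3 : (Φ (g y)).1 = y := (hg y hy).2
      have h4 : (Φ (g z)).1 = z := (hg z hz).2
      rw [h3, h4] at h1 h2
      rw [Real.coe_toNNReal _ (by positivity)]
      linarith
    have himg : S ⊆ g '' (p '' S) := by
      intro s hs
      have hps := hg (p s) (mem_image_of_mem p hs)
      refine ⟨p s, mem_image_of_mem p hs, ?_⟩
      have h1 := hd3 (g (p s)) s
      have h2 := hgraph' _ hps.1 _ hs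
      have h3 : (Φ (g (p s))).1 = (Φ s).1 := hps.2
      rw [h3, dist_self] at h1 h2
      exact dist_le_zero.1 (by linarith)
    have := (measure_mono himg).trans
      (hL.hausdorffMeasure_image_le (d := (m : ℝ)) (by positivity))
    simp only [normHausdorff, Measure.smul_apply, smul_eq_mul]
    rw [mul_left_comm]
    gcongr
    refine this.trans_eq ?_
    rw [ENNReal.rpow_natCast, ENNReal.ofReal_pow (by positivity)]
    rfl
  · intro ρ hρ
    rw [hslice, mul_comm, ← setLIntegral_const]
    refine (setLIntegral_mono' hT.measurableSet ?_).trans (setLIntegral_le_lintegral _ _)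
    rintro _ ⟨s, hs, rfl⟩
    rw [← volume_ball_euclidean (Φ s).2 hρ]
    refine measure_mono fun z hz => mem_thickening_iff.2 ⟨s, hs, ?_⟩
    have h := hd3 (Φ.symm (p s, z)) s
    simp only [MeasurableEquiv.apply_symm_apply] at h
    rw [hp] at h
    simp only [dist_self, zero_add] at h
    exact h.trans_lt hz
  · intro ρ hρ
    rw [hslice, mul_comm, ← setLIntegral_const, ← lintegral_indicator isOpen_thickening.measurableSet]
    refine lintegral_mono fun y => ?_
    have hpy : ∀ z, ∀ s ∈ S, dist (Φ.symm (y, z)) s < ρ → dist y (p s) < ρ ∧ dist z (Φ s).2 < ρ := by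
      intro z s hs hd
      have h1 := hd1 (Φ.symm (y, z)) s
      have h2 := hd2 (Φ.symm (y, z)) s
      simp only [MeasurableEquiv.apply_symm_apply] at h1 h2
      exact ⟨h1.trans_lt hd, h2.trans_lt hd⟩
    by_cases hy : y ∈ thickening ρ (p '' S)
    · rw [indicator_of_mem hy]
      rcases Set.eq_empty_or_nonempty {z | Φ.symm (y, z) ∈ thickening ρ S} with he | ⟨z₀, hz₀⟩
      · rw [he]; simp
      · obtain ⟨s₀, hs₀, hd₀⟩ := mem_thickening_iff.1 hz₀
        rw [← volume_closedBall_euclidean _ (Φ s₀).2 (by positivity)]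
        refine measure_mono fun z hz => ?_
        obtain ⟨s, hs, hd⟩ := mem_thickening_iff.1 hz
        have e1 := hpy z s hs hd
        have e2 := hpy z₀ s₀ hs₀ hd₀
        have e3 := hgraph' s hs s₀ hs₀
        have e4 : dist (p s) (p s₀) ≤ 2 * ρ := by
          have := dist_triangle_left (p s) (p s₀) y
          linarith [e1.1, e2.1]
        have e5 := dist_triangle z (Φ s).2 (Φ s₀).2
        have e6 : η * dist (Φ s).1 (Φ s₀).1 ≤ η * (2 * ρ) := mul_le_mul_of_nonneg_left e4 hη
        rw [mem_closedBall]
        linarith [e1.2]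
    · rw [indicator_of_notMem hy]
      have : {z | Φ.symm (y, z) ∈ thickening ρ S} = ∅ := by
        ext z
        simp only [mem_ofPred_eq, mem_empty_iff_false, iff_false]
        intro hz
        obtain ⟨s, hs, hd⟩ := mem_thickening_iff.1 hz
        exact hy (mem_thickening_iff.2 ⟨p s, mem_image_of_mem p hs, (hpy z s hs hd).1⟩)
      simp [this]

theorem exists_isAlmostFlat {m n : ℕ} {η : ℝ} (hη : 0 < η) (hη1 : η ≤ 1)
    {f : EuclideanSpace ℝ (Fin m) → EuclideanSpace ℝ (Fin n)}
    {A : EuclideanSpace ℝ (Fin m) →L[ℝ] EuclideanSpace ℝ (Fin n)}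
    (hA : Function.Injective A) {K : Set (EuclideanSpace ℝ (Fin m))} {c : ℝ≥0}
    (hc : ∀ v, c * ‖v‖ ≤ η / 2 * ‖A v‖) (hf : ApproximatesLinearOn f A K c)
    {S : Set (EuclideanSpace ℝ (Fin n))} (hS : IsCompact S) (hSK : S ⊆ f '' K) :
    ∃ T, IsAlmostFlat m n η S T := by
  have hV : Module.finrank ℝ (LinearMap.range A.toLinearMap) = m := by
    rw [LinearMap.finrank_range_of_inj hA, finrank_euclideanSpace_fin]
  obtain ⟨Φ, hΦ, hΦc, hsub, hnorm, hzero, -⟩ := exists_orthogonal_splitting _ hV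
  refine ⟨_, isAlmostFlat_of_graph hη.le Φ hΦ hΦc hsub hnorm hS ?_⟩
  intro s hs t ht
  obtain ⟨x, hx, rfl⟩ := hSK hs
  obtain ⟨y, hy, rfl⟩ := hSK ht
  have h1 := (hf x hx y hy).trans (hc (x - y))
  have h2 : (Φ (A (x - y))).2 = 0 := hzero _ ⟨x - y, rfl⟩
  have h3 := hnorm (A (x - y))
  have h4 := hnorm (f x - f y - A (x - y))
  rw [h2] at h3
  rw [hsub, Prod.fst_sub, Prod.snd_sub, h2, sub_zero, hsub, Prod.snd_sub, Prod.fst_sub] at h4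
  set a := ‖A (x - y)‖
  have ha0 : 0 ≤ a := norm_nonneg _
  have ha : a = ‖(Φ (A (x - y))).1‖ :=
    (sq_eq_sq₀ ha0 (norm_nonneg _)).1 (by simpa using h3)
  have h5 : ‖(Φ (f x)).2 - (Φ (f y)).2‖ ≤ η / 2 * a :=
    abs_le_of_sq_le_sq' (b := η / 2 * a) (by
      have := pow_le_pow_left₀ (norm_nonneg _) h1 2
      nlinarith [sq_nonneg ‖(Φ (f x)).1 - (Φ (f y)).1 - (Φ (A (x - y))).1‖]) (by positivity) |>.2
  have h6 : ‖(Φ (f x)).1 - (Φ (f y)).1 - (Φ (A (x - y))).1‖ ≤ η / 2 * a :=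
    abs_le_of_sq_le_sq' (b := η / 2 * a) (by
      have := pow_le_pow_left₀ (norm_nonneg _) h1 2
      nlinarith [sq_nonneg ‖(Φ (f x)).2 - (Φ (f y)).2‖]) (by positivity) |>.2
  have h7 : a - η / 2 * a ≤ ‖(Φ (f x)).1 - (Φ (f y)).1‖ := by
    have := norm_sub_norm_le (Φ (A (x - y))).1 ((Φ (f x)).1 - (Φ (f y)).1)
    rw [norm_sub_rev (Φ (A (x - y))).1, ← ha] at this
    linarith
  have h8 : a ≤ 2 * ‖(Φ (f x)).1 - (Φ (f y)).1‖ := by nlinarith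
  calc _ ≤ η / 2 * a := h5
    _ ≤ η / 2 * (2 * ‖(Φ (f x)).1 - (Φ (f y)).1‖) := by gcongr
    _ = _ := by ring

theorem exists_finset_cover_image {Y X : Type*} [AddGroup Y] [MeasurableSpace Y]
    [MeasurableAdd Y] {μ : Measure Y} [μ.IsAddLeftInvariant] [PseudoMetricSpace X] {f : Y → X}
    {S Q W : Set Y} {ρ : ℝ} (hρ : 0 < ρ) (hQ : MeasurableSet Q) (hQ0 : μ Q ≠ 0) (hW : μ W ≠ ∞)
    (hQW : ∀ x ∈ S, x +ᵥ Q ⊆ W)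
    (hsep : ∀ x ∈ S, ∀ y ∈ S, ¬Disjoint (x +ᵥ Q) (y +ᵥ Q) → dist (f x) (f y) < ρ) :
    ∃ t : Finset X, f '' S ⊆ ⋃ y ∈ t, ball y ρ ∧ t.card * μ Q ≤ μ W := by
  classical
  have hcard : ∀ s : Finset Y, ↑s ⊆ S → (s : Set Y).PairwiseDisjoint (fun x => x +ᵥ Q) →
      s.card * μ Q ≤ μ W := by
    intro s hs hd
    calc (s.card : ℝ≥0∞) * μ Q = ∑ x ∈ s, μ (x +ᵥ Q) := by simp
      _ = μ (⋃ x ∈ s, (x +ᵥ Q)) :=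
        (measure_biUnion_finset hd fun x _ => hQ.const_vadd x).symm
      _ ≤ μ W := measure_mono (iUnion₂_subset fun x hx => hQW x (hs hx))
  by_contra! hcon
  have key : ∀ k : ℕ, ∃ s : Finset Y, ↑s ⊆ S ∧
      (s : Set Y).PairwiseDisjoint (fun x => x +ᵥ Q) ∧ s.card = k := by
    intro k
    induction k with
    | zero => exact ⟨∅, by simp⟩
    | succ k ih =>
      obtain ⟨s, hs, hd, hk⟩ := ih
      have hn : ¬ f '' S ⊆ ⋃ y ∈ s.image f, ball y ρ := fun h => by
        refine (hcon _ h).not_ge ((mul_le_mul_left ?_ _).trans (hcard s hs hd))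
        exact_mod_cast Finset.card_image_le
      rw [image_subset_iff, not_subset] at hn
      obtain ⟨x, hx, hxn⟩ := hn
      have hfar : ∀ y ∈ s, ρ ≤ dist (f x) (f y) := fun y hy => by
        by_contra! h
        exact hxn (mem_iUnion₂.2 ⟨f y, Finset.mem_image_of_mem f hy, h⟩)
      have hxs : x ∉ s := fun h => by
        have := hfar x h
        rw [dist_self] at this
        linarith
      refine ⟨insert x s, by simpa [insert_subset_iff] using ⟨hx, hs⟩, ?_, by
        rw [Finset.card_insert_of_notMem hxs, hk]⟩
      rw [Finset.coe_insert]
      refine hd.insert fun y hy _ => ?_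
      by_contra h
      exact (hsep x hx y (hs hy) h).not_ge (hfar y hy)
  obtain ⟨k, hk⟩ := ENNReal.exists_nat_mul_gt hQ0 hW
  obtain ⟨s, hs, hd, rfl⟩ := key k
  exact hk.not_ge (hcard s hs hd)

/-- `S` can be covered by at most `β / ρ ^ m` balls of radius `ρ`. -/
def HasBallCover {n : ℕ} (m : ℕ) (S : Set (EuclideanSpace ℝ (Fin n))) (ρ : ℝ) (β : ℝ≥0∞) : Prop :=
  ∃ t : Finset (EuclideanSpace ℝ (Fin n)), S ⊆ ⋃ y ∈ t, ball y ρ ∧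
    t.card * ENNReal.ofReal (ρ ^ m) ≤ β

namespace HasBallCover

variable {m n : ℕ} {S : Set (EuclideanSpace ℝ (Fin n))} {ρ : ℝ} {β : ℝ≥0∞}

theorem mono {S' : Set (EuclideanSpace ℝ (Fin n))} {β' : ℝ≥0∞} (h : HasBallCover m S ρ β)
    (hS : S' ⊆ S) (hβ : β ≤ β') : HasBallCover m S' ρ β' :=
  let ⟨t, h1, h2⟩ := h
  ⟨t, hS.trans h1, h2.trans hβ⟩

theorem volume_thickening_le (hmn : m ≤ n) (hρ : 0 < ρ) (h : HasBallCover m S ρ β) {a : ℝ}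
    (ha : 0 ≤ a) :
    volume (thickening (a * ρ) S) ≤
      β * ENNReal.ofReal (unitBallVol n * (1 + a) ^ n * ρ ^ (n - m)) := by
  obtain ⟨t, h1, h2⟩ := h
  have hsub : thickening (a * ρ) S ⊆ ⋃ y ∈ t, ball y ((1 + a) * ρ) := by
    intro z hz
    obtain ⟨s, hs, hd⟩ := mem_thickening_iff.1 hz
    obtain ⟨y, hy, hsy⟩ := mem_iUnion₂.1 (h1 hs)
    refine mem_iUnion₂.2 ⟨y, hy, ?_⟩
    have := dist_triangle z s y
    rw [mem_ball] at hsy ⊢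
    linarith
  have hω := (unitBallVol_pos n).le
  calc volume (thickening (a * ρ) S)
      ≤ ∑ y ∈ t, volume (ball y ((1 + a) * ρ)) :=
        (measure_mono hsub).trans (measure_biUnion_finset_le _ _)
    _ = t.card * ENNReal.ofReal (unitBallVol n * ((1 + a) * ρ) ^ n) := by
        simp [volume_ball_euclidean _ (show 0 < (1 + a) * ρ by positivity)]
    _ = t.card * ENNReal.ofReal (ρ ^ m) *
          ENNReal.ofReal (unitBallVol n * (1 + a) ^ n * ρ ^ (n - m)) := by
        rw [mul_assoc, ← ENNReal.ofReal_mul (by positivity)]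
        congr 2
        rw [mul_pow, ← pow_sub_mul_pow ρ hmn]
        ring
    _ ≤ _ := by gcongr

theorem normHausdorff_le (h : ∀ᶠ ρ in 𝓝[>] (0 : ℝ), HasBallCover m S ρ β) :
    normHausdorff n m S ≤ ENNReal.ofReal (unitBallVol m) * β := by
  obtain ⟨r₀, hr₀, h'⟩ := (mem_nhdsGT_iff_exists_Ioo_subset).1 h
  have hr₀ : 0 < r₀ := hr₀
  set ρ : ℕ → ℝ := fun i => r₀ / (i + 2) with hρ
  have hρ0 : ∀ i, 0 < ρ i := fun i => by positivity
  have hρ1 : ∀ i, HasBallCover m S (ρ i) β := fun i => h' ⟨hρ0 i, by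
    rw [hρ]
    simp only
    rw [div_lt_iff₀ (by positivity)]
    nlinarith [(Nat.cast_nonneg i : (0 : ℝ) ≤ i)]⟩
  choose t ht1 ht2 using hρ1
  have hlim : Tendsto (fun i => ENNReal.ofReal (2 * ρ i)) atTop (𝓝 0) := by
    rw [← ENNReal.ofReal_zero]
    refine ENNReal.tendsto_ofReal ?_
    have : Tendsto ρ atTop (𝓝 0) :=
      Tendsto.const_div_atTop (tendsto_atTop_add_const_right _ _ tendsto_natCast_atTop_atTop) _
    simpa using this.const_mul 2
  have hdiam : ∀ i (y : EuclideanSpace ℝ (Fin n)),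
      ediam (ball y (ρ i)) ≤ ENNReal.ofReal (2 * ρ i) := fun i y => by
    rw [← Metric.eball_ofReal, ENNReal.ofReal_mul (by norm_num), ENNReal.ofReal_ofNat]
    exact Metric.ediam_eball_le
  have key := Measure.hausdorffMeasure_le_liminf_sum (β := ℕ) (ι := fun i => t i) (m : ℝ) S
    (l := atTop) (fun i => ENNReal.ofReal (2 * ρ i)) hlim
    (fun i y => ball (y : EuclideanSpace ℝ (Fin n)) (ρ i))
    (Eventually.of_forall fun i y => hdiam i y)
    (Eventually.of_forall fun i => (ht1 i).trans (by
      intro z hz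
      obtain ⟨y, hy, hz⟩ := mem_iUnion₂.1 hz
      exact mem_iUnion.2 ⟨⟨y, hy⟩, hz⟩))
  have hβ : μH[(m : ℝ)] S ≤ ENNReal.ofReal (2 ^ m) * β := by
    refine key.trans (liminf_le_of_frequently_le' (Frequently.of_forall fun i => ?_))
    calc _ ≤ ∑ y : t i, ENNReal.ofReal (2 * ρ i) ^ (m : ℝ) := by
          gcongr with y
          exact hdiam i y
      _ = ENNReal.ofReal (2 ^ m) * ((t i).card * ENNReal.ofReal (ρ i ^ m)) := by
          rw [Finset.sum_const, ENNReal.rpow_natCast, ← ENNReal.ofReal_pow (by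
            have := hρ0 i; positivity), mul_pow, ENNReal.ofReal_mul (by positivity)]
          simp
          ring
      _ ≤ _ := by
          gcongr
          exact ht2 i
  simp only [normHausdorff, Measure.smul_apply, smul_eq_mul]
  calc _ ≤ ENNReal.ofReal (unitBallVol m / 2 ^ m) * (ENNReal.ofReal (2 ^ m) * β) := by gcongr
    _ = _ := by
      rw [← mul_assoc, ← ENNReal.ofReal_mul (div_nonneg (unitBallVol_pos m).le (by positivity)),
        div_mul_cancel₀ _ (by positivity)]

end HasBallCover

/-- The image of a set on which a map is close to a degenerate linear map has few balls. -/
theorem hasBallCover_of_not_injective {m n : ℕ} {η L : ℝ≥0} (hη : 0 < η) (hηL : η ≤ L)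
    {f : EuclideanSpace ℝ (Fin m) → EuclideanSpace ℝ (Fin n)}
    {A : EuclideanSpace ℝ (Fin m) →L[ℝ] EuclideanSpace ℝ (Fin n)}
    (hA : ¬Function.Injective A) (hAL : ‖A‖ ≤ L) {K : Set (EuclideanSpace ℝ (Fin m))}
    (hf : ApproximatesLinearOn f A K η) {ρ : ℝ} (hρ : 0 < ρ)
    (hfin : volume (thickening (ρ / (4 * η)) K) ≠ ∞) :
    HasBallCover m (f '' K) ρ
      (ENNReal.ofReal (η * (8 ^ m * L ^ (m - 1) / (unitBallVol 1 * unitBallVol (m - 1)))) *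
        volume (thickening (ρ / (4 * η)) K)) := by
  have hL : 0 < L := hη.trans_le hηL
  have hη' : (0 : ℝ) < η := hη
  have hL' : (0 : ℝ) < L := hL
  have hηL' : (η : ℝ) ≤ L := hηL
  obtain ⟨e, he, hAe⟩ : ∃ e, e ≠ 0 ∧ A e = 0 := by
    by_contra! h
    exact hA ((injective_iff_map_eq_zero A).2 fun x hx => by
      by_contra h0
      exact h x h0 hx)
  have hm : 1 ≤ m := by
    rcases m with _ | m
    · exact absurd (Subsingleton.elim e 0) he
    · omega
  obtain ⟨Φ, hΦ, hΦc, hsub, hnorm, hzero, hproj⟩ :=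
    exists_orthogonal_splitting (ℝ ∙ e) (finrank_span_singleton he)
  set a : ℝ := ρ / (8 * η) with ha
  set b : ℝ := ρ / (8 * L) with hb
  have ha0 : 0 < a := by positivity
  have hb0 : 0 < b := by positivity
  have hba : b ≤ a := by rw [ha, hb]; gcongr
  have hnorm_le : ∀ v, ‖v‖ ≤ ‖(Φ v).1‖ + ‖(Φ v).2‖ := fun v =>
    abs_le_of_sq_le_sq' (by
      have := mul_nonneg (norm_nonneg (Φ v).1) (norm_nonneg (Φ v).2)
      nlinarith [hnorm v]) (by positivity) |>.2
  have hAv : ∀ v, ‖A v‖ ≤ L * ‖(Φ v).2‖ := by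
    intro v
    obtain ⟨w, hw, hw1⟩ := hproj v
    have h1 := hnorm (v - w)
    rw [hw1, hsub, Prod.snd_sub, hzero w hw, sub_zero, norm_zero] at h1
    have h2 : ‖v - w‖ = ‖(Φ v).2‖ :=
      (sq_eq_sq₀ (norm_nonneg _) (norm_nonneg _)).1 (by simpa using h1)
    obtain ⟨c, rfl⟩ := Submodule.mem_span_singleton.1 hw
    have h3 : A v = A (v - c • e) := by simp [hAe]
    rw [h3, ← h2]
    exact A.le_of_opNorm_le hAL _
  set Q : Set (EuclideanSpace ℝ (Fin m)) :=
    Φ ⁻¹' (ball (0 : EuclideanSpace ℝ (Fin 1)) a ×ˢ ball (0 : EuclideanSpace ℝ (Fin (m - 1))) b)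
    with hQdef
  have hQm : MeasurableSet Q :=
    (measurableSet_ball.prod measurableSet_ball).preimage Φ.measurable
  have hω1 := unitBallVol_pos 1
  have hωm := unitBallVol_pos (m - 1)
  have hQv : volume Q = ENNReal.ofReal (unitBallVol 1 * a * (unitBallVol (m - 1) * b ^ (m - 1))) := by
    rw [hQdef, hΦ.measure_preimage (measurableSet_ball.prod measurableSet_ball).nullMeasurableSet,
      Measure.volume_eq_prod, Measure.prod_prod, volume_ball_euclidean _ ha0,
      volume_ball_euclidean _ hb0, ← ENNReal.ofReal_mul (by positivity), pow_one]
  have hQ : ∀ v ∈ Q, ‖(Φ v).1‖ < a ∧ ‖(Φ v).2‖ < b := fun v hv => by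
    simpa [hQdef] using hv
  obtain ⟨t, ht1, ht2⟩ := exists_finset_cover_image (μ := volume) (f := f) (S := K) (Q := Q) hρ hQm
    (by rw [hQv, Ne, ENNReal.ofReal_eq_zero, not_le]; positivity) hfin (by
      rintro x hx _ ⟨v, hv, rfl⟩
      refine mem_thickening_iff.2 ⟨x, hx, ?_⟩
      have h1 := hQ v hv
      have h2 := hnorm_le v
      have h3 : ρ / (4 * η) = a + a := by rw [ha]; field_simp; norm_num
      rw [h3, dist_eq_norm]
      simp only [vadd_eq_add, add_sub_cancel_left]
      linarith) (by
      intro x hx y hy hd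
      obtain ⟨z, ⟨v, hv, hvz⟩, ⟨w, hw, hwz⟩⟩ := not_disjoint_iff.1 hd
      simp only [vadd_eq_add] at hvz hwz
      have hxy : x - y = w - v := by
        rw [sub_eq_sub_iff_add_eq_add, hvz, ← hwz, add_comm]
      have h1 := hf x hx y hy
      have h2 := hAv (x - y)
      have h3 := hnorm_le (x - y)
      have hv' := hQ v hv
      have hw' := hQ w hw
      have h4 : ‖(Φ (x - y)).1‖ ≤ a + a := by
        rw [hxy, hsub, Prod.fst_sub]
        linarith [norm_sub_le (Φ w).1 (Φ v).1]
      have h5 : ‖(Φ (x - y)).2‖ ≤ b + b := by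
        rw [hxy, hsub, Prod.snd_sub]
        linarith [norm_sub_le (Φ w).2 (Φ v).2]
      have h6 : ‖f x - f y‖ ≤ ‖f x - f y - A (x - y)‖ + ‖A (x - y)‖ := by
        simpa using norm_add_le (f x - f y - A (x - y)) (A (x - y))
      have h7 : η * ‖x - y‖ ≤ η * (4 * a) := by gcongr; linarith
      have h8 : L * ‖(Φ (x - y)).2‖ ≤ L * (b + b) := by gcongr
      have h9 : η * (4 * a) = ρ / 2 := by rw [ha]; field_simp; norm_num
      have h10 : L * (b + b) = ρ / 4 := by rw [hb]; field_simp; norm_num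
      rw [dist_eq_norm]
      linarith)
  refine ⟨t, ht1, ?_⟩
  have hscale : ENNReal.ofReal (ρ ^ m) = ENNReal.ofReal
      (η * (8 ^ m * L ^ (m - 1) / (unitBallVol 1 * unitBallVol (m - 1)))) * volume Q := by
    rw [hQv, ← ENNReal.ofReal_mul (by positivity)]
    congr 1
    obtain ⟨d, rfl⟩ : ∃ d, m = d + 1 := ⟨m - 1, by omega⟩
    rw [Nat.add_sub_cancel] at hωm ⊢
    rw [ha, hb, div_pow, mul_pow]
    field_simp
    ring
  rw [hscale, mul_left_comm]
  gcongr

/-- Images of arbitrary sets under Lipschitz maps. -/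
theorem hasBallCover_of_lipschitz {m n : ℕ} {L : ℝ≥0} (hL : 0 < L)
    {f : EuclideanSpace ℝ (Fin m) → EuclideanSpace ℝ (Fin n)} (hf : LipschitzWith L f)
    {S W : Set (EuclideanSpace ℝ (Fin m))} {ρ : ℝ} (hρ : 0 < ρ)
    (hfin : volume W ≠ ∞) (hW : ∀ x ∈ S, ball x (ρ / (2 * L)) ⊆ W) :
    HasBallCover m (f '' S) ρ
      (ENNReal.ofReal ((2 * L) ^ m / unitBallVol m) * volume W) := by
  have hL' : (0 : ℝ) < L := hL
  have hω := unitBallVol_pos m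
  set a : ℝ := ρ / (2 * L) with ha
  have ha0 : 0 < a := by positivity
  have hQv : volume (ball (0 : EuclideanSpace ℝ (Fin m)) a) =
      ENNReal.ofReal (unitBallVol m * a ^ m) := volume_ball_euclidean _ ha0
  have hvadd : ∀ x : EuclideanSpace ℝ (Fin m), x +ᵥ ball (0 : EuclideanSpace ℝ (Fin m)) a =
      ball x a := fun x => by
    rw [vadd_ball, vadd_eq_add, add_zero]
  obtain ⟨t, ht1, ht2⟩ := exists_finset_cover_image (μ := volume) (f := f) (S := S)
    (Q := ball (0 : EuclideanSpace ℝ (Fin m)) a) hρ measurableSet_ball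
    (by rw [hQv, Ne, ENNReal.ofReal_eq_zero, not_le]; positivity) hfin
    (fun x hx => by rw [hvadd]; exact hW x hx) (by
      intro x hx y hy hd
      rw [hvadd, hvadd] at hd
      obtain ⟨z, hz1, hz2⟩ := not_disjoint_iff.1 hd
      rw [mem_ball] at hz1 hz2
      have h1 := dist_triangle_left x y z
      calc dist (f x) (f y) ≤ L * dist x y := hf.dist_le_mul x y
        _ < L * (a + a) := by gcongr; linarith
        _ = ρ := by rw [ha]; field_simp; norm_num)
  refine ⟨t, ht1, ?_⟩
  have hscale : ENNReal.ofReal (ρ ^ m) = ENNReal.ofReal ((2 * L) ^ m / unitBallVol m) *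
      volume (ball (0 : EuclideanSpace ℝ (Fin m)) a) := by
    rw [hQv, ← ENNReal.ofReal_mul (by positivity)]
    congr 1
    rw [ha, div_pow]
    field_simp
  rw [hscale, mul_left_comm]
  gcongr

open scoped Function in
/-- Up to small measure, a Lipschitz image of a compact set is a finite disjoint union of compact
sets on which a given function is almost constant, each parametrized by an almost affine map. -/
theorem exists_compact_pieces {m n : ℕ} {L : ℝ≥0}
    {f : EuclideanSpace ℝ (Fin m) → EuclideanSpace ℝ (Fin n)} (hf : LipschitzWith L f)
    {C : Set (EuclideanSpace ℝ (Fin m))} (hC : IsCompact C)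
    {u : EuclideanSpace ℝ (Fin n) → ℝ} (hu0 : ∀ x, 0 ≤ u x) (hu : Continuous u)
    (r : (EuclideanSpace ℝ (Fin m) →L[ℝ] EuclideanSpace ℝ (Fin n)) → ℝ≥0) (hr : ∀ A, r A ≠ 0)
    {δ : ℝ} (hδ : 0 < δ) {ε : ℝ≥0∞} (hε : ε ≠ 0) :
    ∃ (N : ℕ) (E : ℕ → Set (EuclideanSpace ℝ (Fin n))) (K : ℕ → Set (EuclideanSpace ℝ (Fin m)))
      (A : ℕ → EuclideanSpace ℝ (Fin m) →L[ℝ] EuclideanSpace ℝ (Fin n)) (a : ℕ → ℝ),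
      (∀ i, IsCompact (E i)) ∧ Pairwise (Disjoint on E) ∧ (∀ i, IsCompact (K i)) ∧
      (∀ i, K i ⊆ C) ∧ Pairwise (Disjoint on K) ∧ (∀ i, E i ⊆ f '' K i) ∧ (∀ i, ‖A i‖ ≤ L) ∧
      (∀ i, ApproximatesLinearOn f (A i) (K i) (r (A i))) ∧ (∀ i, 0 ≤ a i) ∧
      (∀ i, ∀ x ∈ E i, a i ≤ u x ∧ u x ≤ a i + δ) ∧
      volume (C \ f ⁻¹' ⋃ i ∈ Finset.range N, E i) < ε := by
  set s : Set (EuclideanSpace ℝ (Fin m)) := {x | DifferentiableAt ℝ f x} with hs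
  have hsm : MeasurableSet s := measurableSet_of_differentiableAt ℝ f
  have hs0 : volume sᶜ = 0 := hf.ae_differentiableAt
  have hsne : s.Nonempty := by
    by_contra h
    rw [not_nonempty_iff_eq_empty] at h
    rw [h, compl_empty] at hs0
    exact isOpen_univ.measure_ne_zero volume univ_nonempty hs0
  obtain ⟨t, A, htd, htm, hst, htA, hA⟩ := exists_partition_approximatesLinearOn_of_hasFDerivWithinAt
    f s (fderiv ℝ f) (fun x hx => (DifferentiableAt.hasFDerivAt hx).hasFDerivWithinAt) r hr
  set b : ℕ → Set (EuclideanSpace ℝ (Fin m)) := fun j => {x | ⌊u (f x) / δ⌋₊ = j} with hb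
  have hbm : ∀ j, MeasurableSet (b j) := fun j =>
    (Nat.measurable_floor.comp ((hu.comp hf.continuous).measurable.div_const δ))
      (measurableSet_singleton j)
  set D : ℕ → Set (EuclideanSpace ℝ (Fin m)) :=
    fun l => s ∩ t l.unpair.1 ∩ b l.unpair.2 ∩ C with hD
  have hDm : ∀ l, MeasurableSet (D l) := fun l =>
    ((hsm.inter (htm _)).inter (hbm _)).inter hC.measurableSet
  have hDd : Pairwise (Disjoint on D) := by
    intro l l' hll
    refine disjoint_left.2 fun x hx hx' => hll ?_
    have h1 : l.unpair.1 = l'.unpair.1 := by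
      by_contra h
      exact disjoint_left.1 (htd h) hx.1.1.2 hx'.1.1.2
    have h2 : l.unpair.2 = l'.unpair.2 := hx.1.2.symm.trans hx'.1.2
    rw [← Nat.pair_unpair l, ← Nat.pair_unpair l', h1, h2]
  have hDC : C \ ⋃ l, D l ⊆ sᶜ := by
    rintro x ⟨hxC, hx⟩ hxs
    obtain ⟨i, hi⟩ := mem_iUnion.1 (hst hxs)
    refine hx (mem_iUnion.2 ⟨Nat.pair i ⌊u (f x) / δ⌋₊, ⟨⟨hxs, ?_⟩, ?_⟩, hxC⟩)
    · simpa using hi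
    · simp [hb]
  obtain ⟨ε', hε'0, hε'⟩ := ENNReal.exists_pos_sum_of_countable' (ENNReal.half_pos hε).ne' ℕ
  have hK : ∀ l, ∃ K ⊆ D l, IsCompact K ∧ volume (D l \ K) < ε' l := fun l =>
    (hDm l).exists_isCompact_sdiff_lt
      (measure_ne_top_of_subset inter_subset_right hC.measure_lt_top.ne) (hε'0 l).ne'
  choose K hKD hKc hKε using hK
  set ν : Measure (EuclideanSpace ℝ (Fin n)) := (volume.restrict C).map f with hν
  have : IsFiniteMeasure (volume.restrict C) := ⟨by
    rw [Measure.restrict_apply_univ]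
    exact hC.measure_lt_top⟩
  have hfm : Measurable f := hf.continuous.measurable
  set F : ℕ → Set (EuclideanSpace ℝ (Fin n)) := disjointed fun l => f '' K l with hF
  have hFm : ∀ l, MeasurableSet (F l) :=
    MeasurableSet.disjointed fun l => ((hKc l).image hf.continuous).measurableSet
  have hE : ∀ l, ∃ E ⊆ F l, IsCompact E ∧ ν (F l \ E) < ε' l := fun l =>
    (hFm l).exists_isCompact_sdiff_lt (measure_ne_top _ _) (hε'0 l).ne'
  choose E hEF hEc hEε using hE
  have hEK : ∀ l, E l ⊆ f '' K l := fun l => (hEF l).trans (disjointed_subset _ l)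
  have hsum : volume (C \ f ⁻¹' ⋃ l, E l) < ε := by
    have hsub : C \ f ⁻¹' (⋃ l, E l) ⊆ sᶜ ∪ ((⋃ l, D l \ K l) ∪ ⋃ l, f ⁻¹' (F l \ E l) ∩ C) := by
      rintro x ⟨hxC, hx⟩
      by_cases h1 : x ∈ ⋃ l, D l
      · refine Or.inr ?_
        obtain ⟨l, hl⟩ := mem_iUnion.1 h1
        by_cases h2 : x ∈ K l
        · have h3 : f x ∈ ⋃ l, F l := by
            rw [hF, iUnion_disjointed]
            exact mem_iUnion.2 ⟨l, mem_image_of_mem f h2⟩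
          obtain ⟨l', hl'⟩ := mem_iUnion.1 h3
          exact Or.inr (mem_iUnion.2 ⟨l', ⟨hl', fun h => hx (mem_iUnion.2 ⟨l', h⟩)⟩, hxC⟩)
        · exact Or.inl (mem_iUnion.2 ⟨l, hl, h2⟩)
      · exact Or.inl (hDC ⟨hxC, h1⟩)
    calc volume (C \ f ⁻¹' ⋃ l, E l)
        ≤ volume sᶜ + (∑' l, volume (D l \ K l) + ∑' l, volume (f ⁻¹' (F l \ E l) ∩ C)) :=
          (measure_mono hsub).trans ((measure_union_le _ _).trans (add_le_add le_rfl
            ((measure_union_le _ _).trans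
              (add_le_add (measure_iUnion_le _) (measure_iUnion_le _)))))
      _ ≤ 0 + (∑' l, ε' l + ∑' l, ε' l) := by
          gcongr with l l
          · exact hs0.le
          · exact (hKε l).le
          · have := (hEε l).le
            rwa [hν, Measure.map_apply hfm ((hFm l).diff (hEc l).measurableSet),
              Measure.restrict_apply (hfm ((hFm l).diff (hEc l).measurableSet))] at this
      _ < ε / 2 + ε / 2 := by rw [zero_add]; exact ENNReal.add_lt_add hε' hε'
      _ = ε := ENNReal.add_halves ε
  have hlim : Tendsto (fun N => volume (C \ f ⁻¹' ⋃ i ∈ Finset.range N, E i)) atTop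
      (𝓝 (volume (⋂ N, C \ f ⁻¹' ⋃ i ∈ Finset.range N, E i))) := by
    refine tendsto_measure_iInter_atTop (fun N => ?_) ?_ ⟨0, ?_⟩
    · exact (hC.measurableSet.diff (hfm (Finset.measurableSet_biUnion _
        fun i _ => (hEc i).measurableSet))).nullMeasurableSet
    · intro N N' hN
      refine sdiff_subset_sdiff_right (preimage_mono (biUnion_subset_biUnion_left ?_))
      intro i hi
      exact Finset.mem_range.2 ((Finset.mem_range.1 hi).trans_le hN)
    · exact measure_ne_top_of_subset sdiff_subset hC.measure_lt_top.ne
  have hinter : ⋂ N, C \ f ⁻¹' (⋃ i ∈ Finset.range N, E i) ⊆ C \ f ⁻¹' ⋃ l, E l := by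
    intro x hx
    rw [mem_iInter] at hx
    refine ⟨(hx 0).1, fun h => ?_⟩
    obtain ⟨l, hl⟩ := mem_iUnion.1 h
    exact (hx (l + 1)).2 (mem_iUnion₂.2 ⟨l, by simp, hl⟩)
  obtain ⟨N, hN⟩ := (hlim.eventually_lt_const ((measure_mono hinter).trans_lt hsum)).exists
  refine ⟨N, E, K, fun l => A l.unpair.1, fun l => l.unpair.2 * δ, hEc, ?_, hKc,
    fun l => (hKD l).trans inter_subset_right, ?_, hEK, ?_, ?_, fun l => by positivity, ?_, hN⟩
  · exact fun l l' h => (disjoint_disjointed _ h).mono (hEF l) (hEF l')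
  · exact fun l l' h => (hDd h).mono (hKD l) (hKD l')
  · intro l
    obtain ⟨y, -, hy⟩ := hA hsne l.unpair.1
    simp only [hy]
    exact norm_fderiv_le_of_lipschitz ℝ hf
  · exact fun l => (htA _).mono_set ((hKD l).trans (inter_subset_left.trans inter_subset_left))
  · intro l x hx
    obtain ⟨y, hy, rfl⟩ := hEK l hx
    have h1 : ⌊u (f y) / δ⌋₊ = l.unpair.2 := (hKD l hy).1.2
    have h2 := Nat.floor_le (div_nonneg (hu0 (f y)) hδ.le)
    have h3 := (Nat.lt_floor_add_one (u (f y) / δ)).le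
    rw [h1] at h2 h3
    rw [le_div_iff₀ hδ] at h2
    rw [div_le_iff₀ hδ] at h3
    exact ⟨h2, by linarith⟩

theorem HasBallCover.biUnion {m n : ℕ} {ι : Type*} {s : Finset ι}
    {S : ι → Set (EuclideanSpace ℝ (Fin n))} {ρ : ℝ} {β : ι → ℝ≥0∞}
    (h : ∀ i ∈ s, HasBallCover m (S i) ρ (β i)) :
    HasBallCover m (⋃ i ∈ s, S i) ρ (∑ i ∈ s, β i) := by
  classical
  choose! t ht1 ht2 using h
  refine ⟨s.biUnion t, iUnion₂_subset fun i hi => (ht1 i hi).trans ?_, ?_⟩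
  · refine biUnion_subset_biUnion_left fun y hy => ?_
    exact Finset.mem_biUnion.2 ⟨i, hi, hy⟩
  · calc ((s.biUnion t).card : ℝ≥0∞) * ENNReal.ofReal (ρ ^ m)
        ≤ (∑ i ∈ s, ((t i).card : ℝ≥0∞)) * ENNReal.ofReal (ρ ^ m) := by
          gcongr
          exact_mod_cast Finset.card_biUnion_le
      _ = ∑ i ∈ s, (t i).card * ENNReal.ofReal (ρ ^ m) := Finset.sum_mul _ _ _
      _ ≤ _ := Finset.sum_le_sum ht2

theorem tendsto_volume_thickening {d : ℕ} {K : Set (EuclideanSpace ℝ (Fin d))} (hK : IsCompact K) :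
    Tendsto (fun ρ => volume (thickening ρ K)) (𝓝[>] 0) (𝓝 (volume K)) :=
  tendsto_measure_thickening_of_isClosed
    ⟨1, one_pos, hK.isBounded.thickening.measure_lt_top.ne⟩ hK.isClosed

/-- Constant controlling the degenerate part of a Lipschitz parametrization. -/
def degenerateConst (m : ℕ) (L : ℝ≥0) : ℝ :=
  8 ^ m * L ^ (m - 1) / (unitBallVol 1 * unitBallVol (m - 1))

open scoped Function in
/-- Up to small measure, a Lipschitz image of a compact set is a finite disjoint union of almost flat
compact sets and of a set with small covering numbers. -/
theorem exists_almostFlat_pieces {m n : ℕ} {L : ℝ≥0}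
    {f : EuclideanSpace ℝ (Fin m) → EuclideanSpace ℝ (Fin n)} (hf : LipschitzWith L f)
    {C : Set (EuclideanSpace ℝ (Fin m))} (hC : IsCompact C)
    {u : EuclideanSpace ℝ (Fin n) → ℝ} (hu0 : ∀ x, 0 ≤ u x) (hu : Continuous u)
    {η : ℝ≥0} (hη : 0 < η) (hη1 : η ≤ 1) (hηL : η ≤ L)
    {δ : ℝ} (hδ : 0 < δ) {ε : ℝ≥0∞} (hε : ε ≠ 0) :
    ∃ (s : Finset ℕ) (E : ℕ → Set (EuclideanSpace ℝ (Fin n)))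
      (T : ℕ → Set (EuclideanSpace ℝ (Fin m))) (a : ℕ → ℝ) (G : Set (EuclideanSpace ℝ (Fin n))),
      (∀ i, IsCompact (E i)) ∧ Pairwise (Disjoint on E) ∧ (∀ i, E i ⊆ f '' C) ∧
      (∀ i ∈ s, IsAlmostFlat m n η (E i) (T i)) ∧ (∀ i, 0 ≤ a i) ∧
      (∀ i, ∀ x ∈ E i, a i ≤ u x ∧ u x ≤ a i + δ) ∧ IsCompact G ∧
      (∀ᶠ ρ in 𝓝[>] (0 : ℝ),
        HasBallCover m G ρ (ENNReal.ofReal (η * degenerateConst m L) * (volume C + 1))) ∧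
      volume (C \ f ⁻¹' (G ∪ ⋃ i ∈ s, E i)) < ε := by
  classical
  have hη' : (0 : ℝ) < η := hη
  have hr : ∀ A : EuclideanSpace ℝ (Fin m) →L[ℝ] EuclideanSpace ℝ (Fin n), ∃ c : ℝ≥0, c ≠ 0 ∧
      (Function.Injective A → ∀ v, c * ‖v‖ ≤ η / 2 * ‖A v‖) ∧ (¬Function.Injective A → c = η) := by
    intro A
    by_cases hA : Function.Injective A
    · obtain ⟨κ, hκ, hAκ⟩ := A.toLinearMap.exists_antilipschitzWith
        (LinearMap.ker_eq_bot.2 hA)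
      refine ⟨η / 2 / κ, by positivity, fun _ v => ?_, fun h => absurd hA h⟩
      have h1 : ‖v‖ ≤ κ * ‖A v‖ := by simpa using hAκ.le_mul_dist v 0
      have hκ' : (0 : ℝ) < κ := hκ
      push_cast
      calc (η / 2 / κ * ‖v‖ : ℝ) ≤ η / 2 / κ * (κ * ‖A v‖) := by gcongr
        _ = _ := by field_simp
    · exact ⟨η, hη.ne', fun h => absurd h hA, fun _ => rfl⟩
  choose r hr0 hr1 hr2 using hr
  obtain ⟨N, E, K, A, a, hEc, hEd, hKc, hKC, hKd, hEK, hAL, hAf, ha0, ha, hvol⟩ :=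
    exists_compact_pieces hf hC hu0 hu r hr0 hδ hε
  set s := (Finset.range N).filter fun i => Function.Injective (A i) with hs
  set s' := (Finset.range N).filter fun i => ¬Function.Injective (A i) with hs'
  have hT : ∀ i, ∃ T, i ∈ s → IsAlmostFlat m n η (E i) T := by
    intro i
    by_cases hi : i ∈ s
    · have hinj := (Finset.mem_filter.1 hi).2
      obtain ⟨T, hT⟩ := exists_isAlmostFlat hη' hη1 hinj (hr1 _ hinj) (hAf i) (hEc i) (hEK i)
      exact ⟨T, fun _ => hT⟩
    · exact ⟨∅, fun h => absurd h hi⟩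
  choose T hT using hT
  refine ⟨s, E, T, a, ⋃ i ∈ s', E i, hEc, hEd, fun i => (hEK i).trans (image_mono (hKC i)), hT,
    ha0, ha, s'.isCompact_biUnion fun i _ => hEc i, ?_, ?_⟩
  · have hev : ∀ᶠ ρ in 𝓝[>] (0 : ℝ), ∀ i ∈ s',
        volume (thickening (ρ / (4 * η)) (K i)) < volume (K i) + ((N : ℝ≥0∞) + 1)⁻¹ := by
      rw [Filter.eventually_all_finset]
      intro i _
      have h1 : Tendsto (fun ρ : ℝ => ρ / (4 * η)) (𝓝[>] 0) (𝓝[>] 0) := by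
        refine tendsto_nhdsWithin_iff.2 ⟨?_, ?_⟩
        · exact (Continuous.tendsto' (by fun_prop) _ _ (by simp)).mono_left nhdsWithin_le_nhds
        · filter_upwards [self_mem_nhdsWithin] with ρ hρ
          have : 0 < ρ := hρ
          exact mem_Ioi.2 (by positivity)
      refine ((tendsto_volume_thickening (hKc i)).comp h1).eventually_lt_const ?_
      exact ENNReal.lt_add_right (hKc i).measure_lt_top.ne (by simp)
    filter_upwards [hev, self_mem_nhdsWithin] with ρ hρ hρ0
    have hρ0 : 0 < ρ := hρ0
    refine (HasBallCover.biUnion (β := fun i => ENNReal.ofReal (η * degenerateConst m L) *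
      (volume (K i) + ((N : ℝ≥0∞) + 1)⁻¹)) fun i hi => ?_).mono Subset.rfl ?_
    · have hinj := (Finset.mem_filter.1 hi).2
      refine (hasBallCover_of_not_injective hη hηL hinj (hAL i) ?_ hρ0
        (hρ i hi).ne_top).mono (hEK i) ?_
      · rw [← hr2 _ hinj]
        exact hAf i
      · rw [degenerateConst]
        gcongr
        exact (hρ i hi).le
    · rw [← Finset.mul_sum, Finset.sum_add_distrib]
      gcongr
      · rw [← measure_biUnion_finset (fun i _ j _ h => hKd h)
          fun i _ => (hKc i).measurableSet]
        exact measure_mono (iUnion₂_subset fun i _ => hKC i)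
      · have hcard : s'.card ≤ N := (Finset.card_filter_le _ _).trans (by simp)
        rw [Finset.sum_const, nsmul_eq_mul, ← div_eq_mul_inv]
        refine ENNReal.div_le_of_le_mul ?_
        rw [one_mul]
        exact_mod_cast hcard.trans (Nat.le_succ N)
  · refine (measure_mono ?_).trans_lt hvol
    refine sdiff_subset_sdiff_right (preimage_mono (iUnion₂_subset fun i hi => ?_))
    by_cases hinj : Function.Injective (A i)
    · exact (subset_biUnion_of_mem (u := E)
        (show i ∈ s from Finset.mem_filter.2 ⟨hi, hinj⟩)).trans subset_union_right
    · exact (subset_biUnion_of_mem (u := E)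
        (show i ∈ s' from Finset.mem_filter.2 ⟨hi, hinj⟩)).trans subset_union_left

open scoped Function in
theorem sum_le_liminf_volume {m n : ℕ} (hmn : m < n) {Z : Set (EuclideanSpace ℝ (Fin n))}
    {u : EuclideanSpace ℝ (Fin n) → ℝ} {s : Finset ℕ} {E : ℕ → Set (EuclideanSpace ℝ (Fin n))}
    {T : ℕ → Set (EuclideanSpace ℝ (Fin m))} {a : ℕ → ℝ} {η : ℝ}
    (hEc : ∀ i, IsCompact (E i)) (hEd : Pairwise (Disjoint on E)) (hEZ : ∀ i, E i ⊆ Z)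
    (hT : ∀ i ∈ s, IsAlmostFlat m n η (E i) (T i)) (ha0 : ∀ i, 0 ≤ a i)
    (ha : ∀ i, ∀ x ∈ E i, a i ≤ u x) :
    ∑ i ∈ s, ENNReal.ofReal (a i) ^ (n - m) * volume (T i) ≤
      liminf (fun r : ℝ => volume (⋃ x ∈ Z, ball x (u x * r)) /
        ENNReal.ofReal (unitBallVol (n - m) * r ^ (n - m))) (𝓝[>] 0) := by
  have hω := unitBallVol_pos (n - m)
  have hdisj : ∀ᶠ r in 𝓝[>] (0 : ℝ), ∀ i ∈ s, ∀ j ∈ s, i ≠ j →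
      Disjoint (thickening (a i * r) (E i)) (thickening (a j * r) (E j)) := by
    simp only [Filter.eventually_all_finset]
    intro i _ j _
    by_cases hij : i = j
    · simp [hij]
    obtain ⟨d, hd, hdis⟩ := (hEd hij).exists_thickenings (hEc i) (hEc j).isClosed
    have h : ∀ l, ∀ᶠ r in 𝓝[>] (0 : ℝ), a l * r < d := fun l =>
      ((Continuous.tendsto' (by fun_prop) _ _ (by simp)).mono_left
        nhdsWithin_le_nhds).eventually_lt_const hd
    filter_upwards [h i, h j] with r h1 h2 _
    exact hdis.mono (thickening_mono h1.le _) (thickening_mono h2.le _)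
  refine le_liminf_of_le (by isBoundedDefault) ?_
  filter_upwards [hdisj, self_mem_nhdsWithin] with r hr hr0
  have hr0 : 0 < r := hr0
  rw [ENNReal.le_div_iff_mul_le (Or.inl (by
    rw [Ne, ENNReal.ofReal_eq_zero, not_le]; positivity)) (Or.inl ENNReal.ofReal_ne_top),
    Finset.sum_mul]
  calc _ ≤ ∑ i ∈ s, volume (thickening (a i * r) (E i)) := by
        refine Finset.sum_le_sum fun i hi => ?_
        rcases (ha0 i).eq_or_lt with h | h
        · rw [← h, ENNReal.ofReal_zero, zero_pow (by omega)]
          simp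
        · refine le_trans (le_of_eq ?_) ((hT i hi).le_volume_thickening (a i * r) (by positivity))
          rw [mul_pow, mul_left_comm, ENNReal.ofReal_mul (by positivity : 0 ≤ a i ^ (n - m)),
            ENNReal.ofReal_pow (ha0 i)]
          ring
    _ = volume (⋃ i ∈ s, thickening (a i * r) (E i)) :=
        (measure_biUnion_finset (fun i hi j hj h => hr i hi j hj h)
          fun i _ => isOpen_thickening.measurableSet).symm
    _ ≤ _ := by
        refine measure_mono (iUnion₂_subset fun i _ z hz => ?_)
        obtain ⟨x, hx, hd⟩ := mem_thickening_iff.1 hz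
        exact mem_iUnion₂.2 ⟨x, hEZ i hx, hd.trans_le (by gcongr; exact ha i x hx)⟩

theorem limsup_volume_le_sum {m n : ℕ} (hmn : m < n) {L : ℝ≥0} (hL : 0 < L)
    {f : EuclideanSpace ℝ (Fin m) → EuclideanSpace ℝ (Fin n)} (hf : LipschitzWith L f)
    {C : Set (EuclideanSpace ℝ (Fin m))} (hC : IsCompact C)
    {u : EuclideanSpace ℝ (Fin n) → ℝ} (hu : Continuous u)
    {M : ℝ} (hM : 0 ≤ M) (huM : ∀ x, u x ≤ M)
    {s : Finset ℕ} {E : ℕ → Set (EuclideanSpace ℝ (Fin n))}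
    {T : ℕ → Set (EuclideanSpace ℝ (Fin m))} {a : ℕ → ℝ} {G : Set (EuclideanSpace ℝ (Fin n))}
    {η : ℝ} (hη : 0 ≤ η) {δ : ℝ} (hδ : 0 < δ) {β ε : ℝ≥0∞}
    (hEc : ∀ i, IsCompact (E i))
    (hT : ∀ i ∈ s, IsAlmostFlat m n η (E i) (T i)) (ha0 : ∀ i, 0 ≤ a i)
    (ha : ∀ i, ∀ x ∈ E i, u x ≤ a i + δ) (hGc : IsCompact G)
    (hG : ∀ᶠ ρ in 𝓝[>] (0 : ℝ), HasBallCover m G ρ β)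
    (hvol : volume (C \ f ⁻¹' (G ∪ ⋃ i ∈ s, E i)) < ε) :
    limsup (fun r : ℝ => volume (⋃ x ∈ f '' C, ball x (u x * r)) /
        ENNReal.ofReal (unitBallVol (n - m) * r ^ (n - m))) (𝓝[>] 0) ≤
      ∑ i ∈ s, volume (T i) * ENNReal.ofReal (((1 + 2 * η) * (a i + 3 * δ)) ^ (n - m)) +
      (β * ENNReal.ofReal (unitBallVol n * (1 + (M + δ)) ^ n / unitBallVol (n - m)) +
      ENNReal.ofReal ((2 * L) ^ m / unitBallVol m) * ε *
        ENNReal.ofReal (unitBallVol n * (1 + M / δ) ^ n * δ ^ (n - m) / unitBallVol (n - m))) := by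
  have hω := unitBallVol_pos (n - m)
  have hωn := unitBallVol_pos n
  have hL' : (0 : ℝ) < L := hL
  set B := f ⁻¹' (G ∪ ⋃ i ∈ s, E i) with hB
  have hBc : IsClosed B := (hGc.union (s.isCompact_biUnion fun i _ => hEc i)).isClosed.preimage
    hf.continuous
  have hscale : ∀ c : ℝ, 0 < c → Tendsto (fun r : ℝ => c * r) (𝓝[>] 0) (𝓝[>] 0) := by
    intro c hc
    refine tendsto_nhdsWithin_iff.2 ⟨?_, ?_⟩
    · exact (Continuous.tendsto' (by fun_prop) _ _ (by simp)).mono_left nhdsWithin_le_nhds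
    · filter_upwards [self_mem_nhdsWithin] with ρ hρ
      have : 0 < ρ := hρ
      exact mem_Ioi.2 (by positivity)
  have hZ : IsCompact (f '' C) := hC.image hf.continuous
  have hW : ∀ᶠ r in 𝓝[>] (0 : ℝ), volume (thickening (δ / (2 * L) * r) C \ B) < ε := by
    have h1 : Tendsto (fun ρ => volume.restrict Bᶜ (thickening ρ C)) (𝓝[>] 0)
        (𝓝 (volume.restrict Bᶜ C)) :=
      tendsto_measure_thickening_of_isClosed
        ⟨1, one_pos, ((Measure.restrict_apply_le _ _).trans_lt
          hC.isBounded.thickening.measure_lt_top).ne⟩ hC.isClosed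
    have h2 := (h1.comp (hscale (δ / (2 * L)) (by positivity))).eventually_lt_const
      (by rwa [Measure.restrict_apply hC.measurableSet])
    filter_upwards [h2] with r hr
    rwa [Function.comp_apply, Measure.restrict_apply isOpen_thickening.measurableSet] at hr
  have hunif : ∀ᶠ r in 𝓝[>] (0 : ℝ), ∀ x ∈ f '' C, ∀ y ∈ G ∪ ⋃ i ∈ s, E i,
      dist x y < δ * r → u x ≤ u y + δ := by
    have hcomp : IsCompact (f '' C ∪ (G ∪ ⋃ i ∈ s, E i)) :=
      hZ.union (hGc.union (s.isCompact_biUnion fun i _ => hEc i))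
    obtain ⟨d, hd, hd'⟩ := Metric.uniformContinuousOn_iff.1
      (hcomp.uniformContinuousOn_of_continuous hu.continuousOn) δ hδ
    have : ∀ᶠ r in 𝓝[>] (0 : ℝ), δ * r < d :=
      ((Continuous.tendsto' (by fun_prop) _ _ (by simp)).mono_left
        nhdsWithin_le_nhds).eventually_lt_const hd
    filter_upwards [this] with r hr x hx y hy hxy
    have := hd' x (Or.inl hx) y (Or.inr hy) (hxy.trans hr)
    rw [Real.dist_eq] at this
    linarith [(abs_lt.1 this).2]
  have key : ∀ᶠ r in 𝓝[>] (0 : ℝ), volume (⋃ x ∈ f '' C, ball x (u x * r)) /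
        ENNReal.ofReal (unitBallVol (n - m) * r ^ (n - m)) ≤
      ∑ i ∈ s, volume (thickening ((a i + 3 * δ) * r) (T i)) *
        ENNReal.ofReal (((1 + 2 * η) * (a i + 3 * δ)) ^ (n - m)) +
      (β * ENNReal.ofReal (unitBallVol n * (1 + (M + δ)) ^ n / unitBallVol (n - m)) +
      ENNReal.ofReal ((2 * L) ^ m / unitBallVol m) * ε *
        ENNReal.ofReal (unitBallVol n * (1 + M / δ) ^ n * δ ^ (n - m) / unitBallVol (n - m))) := by
    filter_upwards [hW, hunif, hG, self_mem_nhdsWithin] with r hWr hur hGr hr0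
    have hr0 : 0 < r := hr0
    set S : Set (EuclideanSpace ℝ (Fin m)) :=
      {x ∈ C | ∀ y ∈ G ∪ ⋃ i ∈ s, E i, δ * r ≤ dist (f x) y} with hS
    have hcover : (⋃ x ∈ f '' C, ball x (u x * r)) ⊆
        (⋃ i ∈ s, thickening ((a i + 3 * δ) * r) (E i)) ∪
        (thickening ((M + δ) * r) G ∪ thickening (M / δ * (δ * r)) (f '' S)) := by
      refine iUnion₂_subset ?_
      rintro _ ⟨x, hx, rfl⟩ z hz
      rw [mem_ball] at hz
      by_cases hxS : x ∈ S
      · refine Or.inr (Or.inr (mem_thickening_iff.2 ⟨f x, mem_image_of_mem f hxS, ?_⟩))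
        have h1 : M / δ * (δ * r) = M * r := by field_simp
        rw [h1]
        exact hz.trans_le (by gcongr; exact huM _)
      · obtain ⟨y, hy, hxy⟩ : ∃ y ∈ G ∪ ⋃ i ∈ s, E i, dist (f x) y < δ * r := by
          by_contra! h
          exact hxS ⟨hx, h⟩
        have h1 := hur _ (mem_image_of_mem f hx) y hy hxy
        have h2 := dist_triangle z (f x) y
        rcases hy with hy | hy
        · refine Or.inr (Or.inl (mem_thickening_iff.2 ⟨y, hy, ?_⟩))
          have h3 : u (f x) * r ≤ M * r := by gcongr; exact huM _
          linarith
        · obtain ⟨i, hi, hy⟩ := mem_iUnion₂.1 hy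
          refine Or.inl (mem_iUnion₂.2 ⟨i, hi, mem_thickening_iff.2 ⟨y, hy, ?_⟩⟩)
          have h3 : u (f x) * r ≤ (a i + δ + δ) * r := by
            gcongr
            linarith [ha i y hy]
          linarith
    have hSc : HasBallCover m (f '' S) (δ * r) (ENNReal.ofReal ((2 * L) ^ m / unitBallVol m) * ε) := by
      refine (hasBallCover_of_lipschitz hL hf (S := S)
        (W := thickening (δ / (2 * L) * r) C \ B) (by positivity) hWr.ne_top ?_).mono Subset.rfl
        (by gcongr)
      rintro x hx z hz
      rw [mem_ball] at hz
      have h1 : δ / (2 * L) * r = δ * r / (2 * L) := by ring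
      refine ⟨mem_thickening_iff.2 ⟨x, hx.1, by rwa [h1]⟩, fun hzB => ?_⟩
      have h2 := hx.2 _ hzB
      have h3 := hf.dist_le_mul x z
      rw [dist_comm] at hz
      have h4 : L * dist x z ≤ L * (δ * r / (2 * L)) := by gcongr
      have h5 : L * (δ * r / (2 * L)) = δ * r / 2 := by field_simp
      have h6 : 0 < δ * r := by positivity
      linarith
    refine ENNReal.div_le_of_le_mul ?_
    calc _ ≤ ∑ i ∈ s, volume (thickening ((a i + 3 * δ) * r) (E i)) +
          (volume (thickening ((M + δ) * r) G) + volume (thickening (M / δ * (δ * r)) (f '' S))) :=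
          (measure_mono hcover).trans ((measure_union_le _ _).trans
            (add_le_add (measure_biUnion_finset_le _ _) (measure_union_le _ _)))
      _ ≤ ∑ i ∈ s, volume (thickening ((a i + 3 * δ) * r) (T i)) *
            ENNReal.ofReal (unitBallVol (n - m) * ((1 + 2 * η) * ((a i + 3 * δ) * r)) ^ (n - m)) +
          (β * ENNReal.ofReal (unitBallVol n * (1 + (M + δ)) ^ n * r ^ (n - m)) +
          ENNReal.ofReal ((2 * L) ^ m / unitBallVol m) * ε *
            ENNReal.ofReal (unitBallVol n * (1 + M / δ) ^ n * (δ * r) ^ (n - m))) := by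
          gcongr with i hi
          · exact (hT i hi).volume_thickening_le _ (by have := ha0 i; positivity)
          · exact hGr.volume_thickening_le hmn.le hr0 (by positivity)
          · exact hSc.volume_thickening_le hmn.le (by positivity) (by positivity)
      _ = _ := by
          rw [add_mul, add_mul, Finset.sum_mul]
          have hmul : ∀ (x : ℝ≥0∞) (c d : ℝ), 0 ≤ c →
              x * ENNReal.ofReal c * ENNReal.ofReal d = x * ENNReal.ofReal (c * d) :=
            fun x c d hc => by rw [mul_assoc, ← ENNReal.ofReal_mul hc]
          refine congrArg₂ _ (Finset.sum_congr rfl fun i _ => ?_) (congrArg₂ _ ?_ ?_)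
          · have := ha0 i
            rw [hmul _ _ _ (by positivity)]
            congr 2
            simp only [mul_pow]
            ring
          · rw [hmul _ _ _ (by positivity)]
            congr 2
            field_simp
          · rw [hmul _ _ _ (by positivity)]
            congr 2
            rw [mul_pow]
            field_simp
  refine (limsup_le_limsup key).trans (le_of_eq (Tendsto.limsup_eq ?_))
  refine Tendsto.add_const _ (tendsto_finsetSum _ fun i hi => ?_)
  refine ENNReal.Tendsto.mul_const ?_ (Or.inr ENNReal.ofReal_ne_top)
  exact (tendsto_volume_thickening (hT i hi).isCompact).comp
    (hscale _ (by have := ha0 i; positivity))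

theorem normHausdorff_image_le {m n : ℕ} {L : ℝ≥0}
    {f : EuclideanSpace ℝ (Fin m) → EuclideanSpace ℝ (Fin n)} (hf : LipschitzWith L f)
    (S : Set (EuclideanSpace ℝ (Fin m))) :
    normHausdorff n m (f '' S) ≤ ENNReal.ofReal (L ^ m) * volume S := by
  rw [← normHausdorff_self m]
  simp only [normHausdorff, Measure.smul_apply, smul_eq_mul]
  rw [mul_left_comm]
  gcongr
  refine (hf.hausdorffMeasure_image_le (d := (m : ℝ)) (by positivity) S).trans_eq ?_
  rw [ENNReal.rpow_natCast, ENNReal.ofReal_pow (by positivity), ENNReal.ofReal_coe_nnreal]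

theorem exists_ofReal_mul_le {c t : ℝ} (hc : 0 ≤ c) (ht : 0 < t) :
    ∃ ε : ℝ≥0∞, ε ≠ 0 ∧ ENNReal.ofReal c * ε ≤ ENNReal.ofReal t := by
  refine ⟨ENNReal.ofReal (t / (c + 1)), ?_, ?_⟩
  · rw [Ne, ENNReal.ofReal_eq_zero, not_le]
    positivity
  · rw [← ENNReal.ofReal_mul hc]
    refine ENNReal.ofReal_le_ofReal ?_
    rw [mul_div_assoc', div_le_iff₀ (by positivity)]
    nlinarith

theorem degenerateConst_nonneg (m : ℕ) (L : ℝ≥0) : 0 ≤ degenerateConst m L := by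
  have := unitBallVol_pos 1
  have := unitBallVol_pos (m - 1)
  unfold degenerateConst
  positivity

theorem exists_limsup_volume_le {m n : ℕ} (hmn : m < n) {L : ℝ≥0} (hL : 0 < L)
    {f : EuclideanSpace ℝ (Fin m) → EuclideanSpace ℝ (Fin n)} (hf : LipschitzWith L f)
    {C : Set (EuclideanSpace ℝ (Fin m))} (hC : IsCompact C)
    {u : EuclideanSpace ℝ (Fin n) → ℝ} (hu0 : ∀ x, 0 ≤ u x) (hu : Continuous u)
    {M : ℝ} (hM : 0 ≤ M) (huM : ∀ x, u x ≤ M) :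
    ∃ c : ℝ, ∀ t : ℝ≥0, 0 < t → t ≤ 1 → t ≤ L →
      limsup (fun r : ℝ => volume (⋃ x ∈ f '' C, ball x (u x * r)) /
        ENNReal.ofReal (unitBallVol (n - m) * r ^ (n - m))) (𝓝[>] 0) ≤
      ENNReal.ofReal ((1 + 2 * t) ^ (n - m)) *
        ∫⁻ x in f '' C, ENNReal.ofReal (u x + 3 * t) ^ (n - m) ∂normHausdorff n m +
      ENNReal.ofReal (t * c) := by
  have hω := unitBallVol_pos (n - m)
  have hωn := unitBallVol_pos n
  have hωm := unitBallVol_pos m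
  have hdeg := degenerateConst_nonneg m L
  set V : ℝ := (volume C).toReal + 1 with hV
  have hV0 : 0 < V := by positivity
  have hVeq : volume C + 1 = ENNReal.ofReal V := by
    rw [hV, ENNReal.ofReal_add (by positivity) (by positivity),
      ENNReal.ofReal_toReal hC.measure_lt_top.ne, ENNReal.ofReal_one]
  refine ⟨degenerateConst m L * V * (unitBallVol n * (2 + M) ^ n / unitBallVol (n - m)) + 1,
    fun t ht ht1 htL => ?_⟩
  have ht' : (0 : ℝ) < t := ht
  have ht1' : (t : ℝ) ≤ 1 := ht1
  obtain ⟨ε, hε0, hε⟩ := exists_ofReal_mul_le (c := (2 * L) ^ m / unitBallVol m *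
    (unitBallVol n * (1 + M / t) ^ n * t ^ (n - m) / unitBallVol (n - m))) (by positivity) ht'
  obtain ⟨s, E, T, a, G, hEc, hEd, hEZ, hT, ha0, ha, hGc, hG, hvol⟩ :=
    exists_almostFlat_pieces hf hC hu0 hu ht ht1 htL ht' hε0
  refine (limsup_volume_le_sum hmn hL hf hC hu hM huM ht'.le ht' hEc hT ha0
    (fun i x hx => (ha i x hx).2) hGc hG hvol).trans ?_
  refine add_le_add ?_ ?_
  · calc _ ≤ ∑ i ∈ s, ENNReal.ofReal ((1 + 2 * t) ^ (n - m)) *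
          ∫⁻ x in E i, ENNReal.ofReal (u x + 3 * t) ^ (n - m) ∂normHausdorff n m := by
          refine Finset.sum_le_sum fun i hi => ?_
          have := ha0 i
          rw [mul_pow, ENNReal.ofReal_mul (by positivity), mul_left_comm]
          gcongr
          rw [ENNReal.ofReal_pow (by positivity), mul_comm]
          calc _ ≤ ENNReal.ofReal (a i + 3 * t) ^ (n - m) * normHausdorff n m (E i) := by
                gcongr
                exact (hT i hi).volume_le
            _ = ∫⁻ x in E i, ENNReal.ofReal (a i + 3 * t) ^ (n - m) ∂normHausdorff n m :=
                (setLIntegral_const _ _).symm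
            _ ≤ _ := by
                refine setLIntegral_mono' (hEc i).measurableSet fun x hx => ?_
                gcongr
                exact (ha i x hx).1
      _ = ENNReal.ofReal ((1 + 2 * t) ^ (n - m)) *
          ∫⁻ x in ⋃ i ∈ s, E i, ENNReal.ofReal (u x + 3 * t) ^ (n - m) ∂normHausdorff n m := by
          rw [← Finset.mul_sum, lintegral_biUnion_finset (fun i _ j _ h => hEd h)
            fun i _ => (hEc i).measurableSet]
      _ ≤ _ := by
          gcongr
          exact iUnion₂_subset fun i _ => hEZ i
  · rw [mul_add (t : ℝ), mul_one, ENNReal.ofReal_add (by positivity) ht'.le]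
    refine add_le_add ?_ (le_trans (le_of_eq ?_) hε)
    · rw [hVeq, ← ENNReal.ofReal_mul (by positivity), ← ENNReal.ofReal_mul (by positivity)]
      refine ENNReal.ofReal_le_ofReal ?_
      have h1 : (1 + (M + t)) ^ n ≤ (2 + M) ^ n := by
        gcongr ?_ ^ n
        linarith
      calc _ ≤ t * degenerateConst m L * V * (unitBallVol n * (2 + M) ^ n / unitBallVol (n - m)) := by
            gcongr
        _ = _ := by ring
    · rw [mul_right_comm, ← ENNReal.ofReal_mul (by positivity)]

theorem exists_lintegral_le_liminf_volume {m n : ℕ} (hmn : m < n) {L : ℝ≥0}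
    {f : EuclideanSpace ℝ (Fin m) → EuclideanSpace ℝ (Fin n)} (hf : LipschitzWith L f)
    {C : Set (EuclideanSpace ℝ (Fin m))} (hC : IsCompact C)
    {u : EuclideanSpace ℝ (Fin n) → ℝ} (hu0 : ∀ x, 0 ≤ u x) (hu : Continuous u)
    {M : ℝ} (hM : 0 ≤ M) (huM : ∀ x, u x ≤ M) :
    ∃ c : ℝ, ∀ t : ℝ≥0, 0 < t → t ≤ 1 → t ≤ L →
      ∫⁻ x in f '' C, ENNReal.ofReal (u x - t) ^ (n - m) ∂normHausdorff n m ≤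
      ENNReal.ofReal ((1 + t) ^ m) *
        liminf (fun r : ℝ => volume (⋃ x ∈ f '' C, ball x (u x * r)) /
          ENNReal.ofReal (unitBallVol (n - m) * r ^ (n - m))) (𝓝[>] 0) +
      ENNReal.ofReal (t * c) := by
  have hωm := unitBallVol_pos m
  have hdeg := degenerateConst_nonneg m L
  set V : ℝ := (volume C).toReal + 1 with hV
  have hV0 : 0 < V := by positivity
  have hVeq : volume C + 1 = ENNReal.ofReal V := by
    rw [hV, ENNReal.ofReal_add (by positivity) (by positivity),
      ENNReal.ofReal_toReal hC.measure_lt_top.ne, ENNReal.ofReal_one]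
  refine ⟨M ^ (n - m) * (unitBallVol m * (degenerateConst m L * V)) + 1, fun t ht ht1 htL => ?_⟩
  have ht' : (0 : ℝ) < t := ht
  obtain ⟨ε, hε0, hε⟩ := exists_ofReal_mul_le (c := M ^ (n - m) * L ^ m) (by positivity) ht'
  obtain ⟨s, E, T, a, G, hEc, hEd, hEZ, hT, ha0, ha, hGc, hG, hvol⟩ :=
    exists_almostFlat_pieces hf hC hu0 hu ht ht1 htL ht' hε0
  set B := f ⁻¹' (G ∪ ⋃ i ∈ s, E i) with hB
  have hle : ∀ S, ∫⁻ x in S, ENNReal.ofReal (u x - t) ^ (n - m) ∂normHausdorff n m ≤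
      ENNReal.ofReal (M ^ (n - m)) * normHausdorff n m S := fun S => by
    rw [← setLIntegral_const]
    refine lintegral_mono fun x => ?_
    rw [ENNReal.ofReal_pow hM]
    gcongr
    linarith [huM x]
  have hsub : f '' C ⊆ (⋃ i ∈ s, E i) ∪ (G ∪ f '' (C \ B)) := by
    rintro _ ⟨x, hx, rfl⟩
    by_cases hxB : x ∈ B
    · rcases hxB with h | h
      · exact Or.inr (Or.inl h)
      · exact Or.inl h
    · exact Or.inr (Or.inr (mem_image_of_mem f ⟨hx, hxB⟩))
  refine (lintegral_mono_set hsub).trans ((lintegral_union_le _ _ _).trans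
    (add_le_add ?_ ((lintegral_union_le _ _ _).trans ?_)))
  · rw [lintegral_biUnion_finset (fun i _ j _ h => hEd h) fun i _ => (hEc i).measurableSet]
    calc _ ≤ ∑ i ∈ s, ENNReal.ofReal ((1 + t) ^ m) *
          (ENNReal.ofReal (a i) ^ (n - m) * volume (T i)) := by
          refine Finset.sum_le_sum fun i hi => ?_
          calc _ ≤ ∫⁻ x in E i, ENNReal.ofReal (a i) ^ (n - m) ∂normHausdorff n m := by
                refine setLIntegral_mono' (hEc i).measurableSet fun x hx => ?_
                gcongr
                linarith [(ha i x hx).2]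
            _ = ENNReal.ofReal (a i) ^ (n - m) * normHausdorff n m (E i) := setLIntegral_const _ _
            _ ≤ ENNReal.ofReal (a i) ^ (n - m) * (ENNReal.ofReal ((1 + t) ^ m) * volume (T i)) := by
                gcongr
                exact (hT i hi).le_volume
            _ = _ := mul_left_comm _ _ _
      _ ≤ _ := by
          rw [← Finset.mul_sum]
          gcongr
          exact sum_le_liminf_volume hmn hEc hEd hEZ hT ha0 fun i x hx => (ha i x hx).1
  · rw [mul_add, mul_one, ENNReal.ofReal_add (by positivity) ht'.le]
    refine add_le_add ((hle G).trans ?_) ((hle _).trans (le_trans ?_ hε))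
    · calc _ ≤ ENNReal.ofReal (M ^ (n - m)) * (ENNReal.ofReal (unitBallVol m) *
            (ENNReal.ofReal (t * degenerateConst m L) * (volume C + 1))) := by
            gcongr
            exact HasBallCover.normHausdorff_le hG
        _ = _ := by
            rw [hVeq, ← ENNReal.ofReal_mul (by positivity), ← ENNReal.ofReal_mul (by positivity),
              ← ENNReal.ofReal_mul (by positivity)]
            congr 1
            ring
    · rw [ENNReal.ofReal_mul (by positivity), mul_assoc]
      gcongr
      refine (normHausdorff_image_le hf _).trans ?_
      gcongr

theorem tendsto_lintegral_ofReal_pow {X : Type*} [MeasurableSpace X] {μ : Measure X}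
    [IsFiniteMeasure μ] {u : X → ℝ} (hu : Measurable u) {M : ℝ} (huM : ∀ x, u x ≤ M) (c : ℝ)
    (k : ℕ) :
    Tendsto (fun t : ℝ≥0 => ∫⁻ x, ENNReal.ofReal (u x + c * t) ^ k ∂μ) (𝓝[>] 0)
      (𝓝 (∫⁻ x, ENNReal.ofReal (u x) ^ k ∂μ)) := by
  refine tendsto_lintegral_filter_of_dominated_convergence
    (fun _ => ENNReal.ofReal (M + |c|) ^ k) (Eventually.of_forall fun t => by fun_prop) ?_ ?_ ?_
  · have h1 : ∀ᶠ t : ℝ≥0 in 𝓝[>] 0, t < 1 :=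
      (tendsto_id.mono_left nhdsWithin_le_nhds).eventually_lt_const one_pos
    filter_upwards [h1] with t ht
    refine Eventually.of_forall fun x => ?_
    have ht' : (t : ℝ) ≤ 1 := ht.le
    gcongr
    · exact huM x
    · calc c * t ≤ |c| * t := by gcongr; exact le_abs_self c
        _ ≤ |c| * 1 := by gcongr
        _ = |c| := mul_one _
  · rw [lintegral_const]
    finiteness
  · refine Eventually.of_forall fun x => Tendsto.mono_left ?_ nhdsWithin_le_nhds
    refine ENNReal.Tendsto.pow (ENNReal.tendsto_ofReal ?_)
    exact Continuous.tendsto' (by fun_prop) _ _ (by simp)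

/-- For `0 ≤ m < n`, a compact `m`-rectifiable set `E ⊆ ℝⁿ` and a bounded
continuous `u : ℝⁿ → [0,∞)`, the `m`-dimensional `u`-Minkowski content of `E` exists and equals
the weighted Hausdorff integral:
`lim_{r→0⁺} H^n(⋃_{x∈E} B(x, u(x)·r)) / (ω(n−m)·r^{n−m}) = ∫_E u(x)^{n−m} dH^m(x)`. -/
theorem u_minkowski_content_eq {m n : ℕ} (hmn : m < n)
    (E : Set (EuclideanSpace ℝ (Fin n))) (hEcpt : IsCompact E) (hE : MRectifiable m n E)
    (u : EuclideanSpace ℝ (Fin n) → ℝ) (hu0 : ∀ x, 0 ≤ u x)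
    (hubd : ∃ C : ℝ, ∀ x, u x ≤ C) (hucont : Continuous u) :
    Filter.Tendsto
      (fun r : ℝ =>
        normHausdorff n n (⋃ x ∈ E, Metric.ball x (u x * r)) /
          ENNReal.ofReal (unitBallVol (n - m) * r ^ (n - m)))
      (nhdsWithin 0 (Set.Ioi 0))
      (nhds (∫⁻ x in E, ENNReal.ofReal (u x) ^ (n - m) ∂(normHausdorff n m))) := by
  obtain ⟨F, Ψ, κ, hF, hΨ, rfl⟩ := hE
  obtain ⟨M, hM⟩ := hubd
  have hM0 : 0 ≤ M := (hu0 0).trans (hM 0)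
  obtain ⟨f, hf, hfΨ⟩ := hΨ.extend_finite_dimension
  obtain ⟨L, hL, hfL⟩ : ∃ L : ℝ≥0, 0 < L ∧ LipschitzWith L f :=
    ⟨_, by positivity, hf.weaken (le_add_of_nonneg_right zero_le_one)⟩
  have hC : IsCompact (closure F) := hF.isCompact_closure
  have himg : Ψ '' F = f '' closure F := by
    rw [hfΨ.image_eq] at hEcpt ⊢
    exact (image_mono subset_closure).antisymm
      ((image_closure_subset_closure_image hfL.continuous).trans hEcpt.isClosed.closure_eq.subset)
  rw [himg, normHausdorff_self]
  have hfin : IsFiniteMeasure ((normHausdorff n m).restrict (f '' closure F)) := ⟨by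
    rw [Measure.restrict_apply_univ]
    exact (normHausdorff_image_le hfL _).trans_lt
      (ENNReal.mul_lt_top ENNReal.ofReal_lt_top hC.measure_lt_top)⟩
  have hsmall : ∀ᶠ t : ℝ≥0 in 𝓝[>] 0, 0 < t ∧ t ≤ 1 ∧ t ≤ L := by
    have h : ∀ a : ℝ≥0, 0 < a → ∀ᶠ t : ℝ≥0 in 𝓝[>] 0, t ≤ a := fun a ha =>
      (((tendsto_id.mono_left nhdsWithin_le_nhds).eventually_lt_const ha)).mono fun _ => le_of_lt
    filter_upwards [self_mem_nhdsWithin, h 1 one_pos, h L hL] with t h1 h2 h3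
    exact ⟨h1, h2, h3⟩
  have hofReal : ∀ g : ℝ≥0 → ℝ, Continuous g →
      Tendsto (fun t => ENNReal.ofReal (g t)) (𝓝[>] 0) (𝓝 (ENNReal.ofReal (g 0))) :=
    fun g hg => ((ENNReal.continuous_ofReal.comp hg).tendsto 0).mono_left nhdsWithin_le_nhds
  refine tendsto_of_le_liminf_of_limsup_le ?_ ?_
  · obtain ⟨c, hc⟩ := exists_lintegral_le_liminf_volume hmn hfL hC hu0 hucont hM0 hM
    have h1 := tendsto_lintegral_ofReal_pow (μ := (normHausdorff n m).restrict (f '' closure F))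
      hucont.measurable hM (-1) (n - m)
    have h2 := (ENNReal.Tendsto.mul_const (b := liminf (fun r : ℝ =>
      volume (⋃ x ∈ f '' closure F, ball x (u x * r)) /
        ENNReal.ofReal (unitBallVol (n - m) * r ^ (n - m))) (𝓝[>] 0))
      (hofReal (fun t => (1 + t) ^ m) (by fun_prop)) (Or.inl (by simp))).add
      (hofReal (fun t => t * c) (by fun_prop))
    simp only [NNReal.coe_zero, add_zero, one_pow, ENNReal.ofReal_one, one_mul, zero_mul,
      ENNReal.ofReal_zero] at h2
    refine le_of_tendsto_of_tendsto h1 h2 ?_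
    filter_upwards [hsmall] with t ht
    simpa [sub_eq_add_neg] using hc t ht.1 ht.2.1 ht.2.2
  · obtain ⟨c, hc⟩ := exists_limsup_volume_le hmn hL hfL hC hu0 hucont hM0 hM
    have h1 := tendsto_lintegral_ofReal_pow (μ := (normHausdorff n m).restrict (f '' closure F))
      hucont.measurable hM 3 (n - m)
    have h2 := (ENNReal.Tendsto.mul
      (hofReal (fun t => (1 + 2 * t) ^ (n - m)) (by fun_prop)) (Or.inl (by simp)) h1
      (Or.inr ENNReal.ofReal_ne_top)).add
      (hofReal (fun t => t * c) (by fun_prop))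
    simp only [NNReal.coe_zero, mul_zero, add_zero, one_pow, ENNReal.ofReal_one, one_mul, zero_mul,
      ENNReal.ofReal_zero] at h2
    refine ge_of_tendsto h2 ?_
    filter_upwards [hsmall] with t ht
    exact hc t ht.1 ht.2.1 ht.2.2
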